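/- arXiv:2110.14047 — 2 statements merged into one kernel-verified Lean document; each statement's English description precedes it below -/
import Mathlib

section
/- δ-optimality of the shape function program: Under the assumptions that [0,T], Ω, Ω₀ ⊆ Ω, S, X, X_u ⊆ X are compact, f : ℝ × ℝ^{N_ω} → ℝ^{N_ω} is Lipschitz in each argument, c is continuous on X × X_u, A : S × Ω → X is continuous, and the non-return properties hold for the orientation state and the shape image, for every δ > 0 there exists a shape-dual-feasible quadruple (γ, v, w, z) with P* − δ ≤ γ ≤ P*, where P* is the infimum of c(A(s; ω(t_p | ω₀)), y) over t_p ∈ [0,T], ω₀ ∈ Ω₀, s ∈ S, y ∈ X_u along solutions of ω̇ = f(t,ω). In particular the optimal value d* of the shape function program satisfies d* = P*. -/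
open MeasureTheory Set

noncomputable section

/-- `ℝⁿ` -/
abbrev Vec (n : ℕ) : Type := EuclideanSpace ℝ (Fin n)

/-- Lie derivative of `v` along the vector field `f`. -/
def LieD {n : ℕ} (f : ℝ × Vec n → Vec n) (v : ℝ × Vec n → ℝ) (p : ℝ × Vec n) : ℝ :=
  fderiv ℝ v p ((1 : ℝ), f p)


/-- A shape-dual-feasible quadruple `(γ, v, w, z)` for the shape distance function
program. -/
def ShapeDualFeasible {nw ns n : ℕ} (T : ℝ) (Om Om0 : Set (Vec nw)) (S : Set (Vec ns))
    (X Xu : Set (Vec n)) (A : Vec ns × Vec nw → Vec n) (f : ℝ × Vec nw → Vec nw)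
    (c : Vec n × Vec n → ℝ)
    (γ : ℝ) (v : ℝ × Vec nw → ℝ) (w : Vec n → ℝ) (z : Vec nw → ℝ) : Prop :=
  ContDiff ℝ 1 v ∧ Continuous w ∧ Continuous z ∧
  (∀ om ∈ Om0, γ ≤ v (0, om)) ∧
  (∀ x ∈ X, ∀ y ∈ Xu, w x ≤ c (x, y)) ∧
  (∀ s ∈ S, ∀ om ∈ Om, z om ≤ w (A (s, om))) ∧
  (∀ t ∈ Icc 0 T, ∀ om ∈ Om, v (t, om) ≤ z om) ∧
  (∀ t ∈ Icc 0 T, ∀ om ∈ Om, 0 ≤ LieD f v (t, om))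

/-- An admissible orientation trajectory: `t_p ∈ [0,T]`, `ω(0) ∈ Ω₀`, `ω` solves
`ω̇ = f(t,ω)` on `[0, t_p]` and remains in `Ω` there. -/
def ShapeAdmissible {nw : ℕ} (T : ℝ) (Om Om0 : Set (Vec nw)) (f : ℝ × Vec nw → Vec nw)
    (om : ℝ → Vec nw) (tp : ℝ) : Prop :=
  tp ∈ Icc 0 T ∧ om 0 ∈ Om0 ∧ (∀ t ∈ Icc 0 tp, HasDerivAt om (f (t, om t)) t) ∧
  ∀ t ∈ Icc 0 tp, om t ∈ Om

/-- The shape minimal distance `P*`. -/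
def ShapePStar {nw ns n : ℕ} (T : ℝ) (Om Om0 : Set (Vec nw)) (S : Set (Vec ns))
    (Xu : Set (Vec n)) (A : Vec ns × Vec nw → Vec n) (f : ℝ × Vec nw → Vec nw)
    (c : Vec n × Vec n → ℝ) : ℝ :=
  sInf {r | ∃ (om : ℝ → Vec nw) (tp : ℝ) (s : Vec ns) (y : Vec n),
    ShapeAdmissible T Om Om0 f om tp ∧ s ∈ S ∧ y ∈ Xu ∧ r = c (A (s, om tp), y)}

section

open Filter Topology Metric in
/-- Mollification of a Lipschitz function: the directional growth rate along a Lipschitz vector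
field is preserved up to an error controlled by the radius. -/
theorem exists_contDiff_approx_of_growth {P : Type*} [NormedAddCommGroup P] [NormedSpace ℝ P]
    [FiniteDimensional ℝ P] {u : P → ℝ} {L : NNReal} (hu : LipschitzWith L u)
    {G : P → P} {k : NNReal} (hG : LipschitzWith k G) {η : ℝ} (hη : 0 < η) :
    ∃ v : P → ℝ, ContDiff ℝ 1 v ∧ (∀ p, |v p - u p| ≤ L * η) ∧
      ∀ p e C h₀, 0 < h₀ →
        (∀ q ∈ ball p η, ∀ h ∈ Ioo 0 h₀, u q + e * h - C * h ^ 2 ≤ u (q + h • G q)) →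
        e - L * k * η ≤ fderiv ℝ v p (G p) := by
  borelize P
  let μ : Measure P := Measure.addHaar
  let φ : ContDiffBump (0 : P) := ⟨η / 2, η, half_pos hη, half_lt_self hη⟩
  have hcs : HasCompactSupport (φ.normed μ) := φ.hasCompactSupport_normed
  have hloc : LocallyIntegrable u μ := hu.continuous.locallyIntegrable
  let v := convolution (φ.normed μ) u (ContinuousLinearMap.lsmul ℝ ℝ) μ
  have hvd : ContDiff ℝ 1 v := by
    simpa using hcs.contDiff_convolution_left (n := 1) (ContinuousLinearMap.lsmul ℝ ℝ)
      φ.contDiff_normed hloc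
  have hint : ∀ p, Integrable (fun r => φ.normed μ r * u (p - r)) μ := fun p =>
    (hcs.convolutionExists_left (ContinuousLinearMap.lsmul ℝ ℝ) φ.continuous_normed hloc p).integrable
  have hv : ∀ p, v p = ∫ r, φ.normed μ r * u (p - r) ∂μ := fun p => rfl
  refine ⟨v, hvd, fun p => ?_, fun p e C h₀ hh₀ H => ?_⟩
  · rw [← Real.dist_eq]
    refine φ.dist_normed_convolution_le hu.continuous.aestronglyMeasurable fun x hx => ?_
    refine (hu.dist_le_mul x p).trans ?_
    gcongr
    exact (mem_ball.1 hx).le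
  · have hderiv : HasDerivAt (fun t : ℝ => v (p + t • G p)) (fderiv ℝ v p (G p)) 0 := by
      have := ((hvd.differentiable one_ne_zero) p).hasFDerivAt.hasLineDerivAt (G p)
      exact this
    have hlim := hderiv.tendsto_slope_zero_right
    simp only [zero_add, zero_smul, add_zero, smul_eq_mul] at hlim
    have hlow : Tendsto (fun h : ℝ => e - L * k * η - C * h) (𝓝[>] 0) (𝓝 (e - L * k * η)) := by
      have : Continuous fun h : ℝ => e - L * k * η - C * h := by fun_prop
      simpa using (this.tendsto 0).mono_left nhdsWithin_le_nhds
    refine le_of_tendsto_of_tendsto hlow hlim ?_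
    filter_upwards [Ioo_mem_nhdsGT hh₀] with h hh
    rw [← div_eq_inv_mul, le_div_iff₀ hh.1, hv, hv, ← integral_sub (hint _) (hint _)]
    have h1 : (e - L * k * η - C * h) * h
        = ∫ r, φ.normed μ r * ((e - L * k * η - C * h) * h) ∂μ := by
      rw [integral_mul_const, φ.integral_normed, one_mul]
    rw [h1]
    refine integral_mono (φ.integrable_normed.mul_const _) ((hint _).sub (hint _)) fun r => ?_
    by_cases hr : r ∈ ball (0 : P) η
    · have hq : p - r ∈ ball p η := by simpa [mem_ball, dist_eq_norm] using hr
      have h2 := H _ hq h hh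
      have h3 := (abs_le.1 ((Real.dist_eq _ _).symm.trans_le
        (hu.dist_le_mul (p + h • G p - r) (p - r + h • G (p - r))))).1
      have h4 : dist (p + h • G p - r) (p - r + h • G (p - r)) ≤ h * (k * η) := by
        have : p + h • G p - r - (p - r + h • G (p - r)) = h • (G p - G (p - r)) := by module
        rw [dist_eq_norm, this, norm_smul, Real.norm_of_nonneg hh.1.le, ← dist_eq_norm]
        refine mul_le_mul_of_nonneg_left ((hG.dist_le_mul _ _).trans ?_) hh.1.le
        gcongr
        rw [dist_comm]
        exact (mem_ball.1 hq).le
      have h5 : (L : ℝ) * dist (p + h • G p - r) (p - r + h • G (p - r)) ≤ L * (h * (k * η)) := by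
        gcongr
      have h6 := φ.nonneg_normed (μ := μ) r
      simp only [← mul_sub]
      refine mul_le_mul_of_nonneg_left ?_ h6
      nlinarith
    · have : φ.normed μ r = 0 := by
        rw [← Function.notMem_support, φ.support_normed_eq]; exact hr
      simp [this]

variable {E : Type*} [NormedAddCommGroup E] [NormedSpace ℝ E]

theorem IsIntegralCurveOn.dist_le_of_le {F : ℝ → E → E} {K : NNReal}
    (hF : ∀ t, LipschitzWith K (F t)) {x y : ℝ → E} {a b : ℝ}
    (hx : IsIntegralCurveOn x F (Icc a b)) (hy : IsIntegralCurveOn y F (Icc a b)) {s t : ℝ}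
    (hs : s ∈ Icc a b) (ht : t ∈ Icc a b) (hst : s ≤ t) :
    dist (x t) (y t) ≤ dist (x s) (y s) * Real.exp (K * (t - s)) := by
  have hsub : Icc s t ⊆ Icc a b := Icc_subset_Icc hs.1 ht.2
  have key : ∀ {x : ℝ → E}, IsIntegralCurveOn x F (Icc a b) →
      ∀ r ∈ Ico s t, HasDerivWithinAt x (F r (x r)) (Ici r) r := fun {x} hx r hr =>
    (hx r (hsub ⟨hr.1, hr.2.le⟩)).mono_of_mem_nhdsWithin <|
      Filter.mem_of_superset (Icc_mem_nhdsGE hr.2) (Icc_subset_Icc (hs.1.trans hr.1) ht.2)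
  exact dist_le_of_trajectories_ODE hF (hx.continuousOn.mono hsub) (key hx)
    (hy.continuousOn.mono hsub) (key hy) le_rfl t ⟨hst, le_rfl⟩

theorem IsIntegralCurveOn.comp_neg_Icc {F : ℝ → E → E} {x : ℝ → E} {a b : ℝ}
    (hx : IsIntegralCurveOn x F (Icc a b)) :
    IsIntegralCurveOn (fun t => x (-t)) (fun t y => -F (-t) y) (Icc (-b) (-a)) := by
  intro t ht
  have h1 : HasDerivWithinAt (fun t : ℝ => -t) (-1) (Icc (-b) (-a)) t :=
    (hasDerivAt_neg t).hasDerivWithinAt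
  have h2 := (hx (-t) ⟨by linarith [ht.2], by linarith [ht.1]⟩).scomp t h1
    (fun r hr => ⟨by linarith [hr.2], by linarith [hr.1]⟩)
  simpa [Function.comp_def] using h2

theorem IsIntegralCurveOn.dist_le {F : ℝ → E → E} {K : NNReal}
    (hF : ∀ t, LipschitzWith K (F t)) {x y : ℝ → E} {a b : ℝ}
    (hx : IsIntegralCurveOn x F (Icc a b)) (hy : IsIntegralCurveOn y F (Icc a b)) {s t : ℝ}
    (hs : s ∈ Icc a b) (ht : t ∈ Icc a b) :
    dist (x t) (y t) ≤ dist (x s) (y s) * Real.exp (K * (b - a)) := by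
  rcases le_total s t with h | h
  · refine (hx.dist_le_of_le hF hy hs ht h).trans ?_
    gcongr <;> linarith [hs.1, ht.2]
  · have := hx.comp_neg_Icc.dist_le_of_le (fun t => (hF (-t)).neg) hy.comp_neg_Icc
      (s := -s) (t := -t) ⟨by linarith [hs.2], by linarith [hs.1]⟩
      ⟨by linarith [ht.2], by linarith [ht.1]⟩ (by linarith)
    simp only [neg_neg] at this
    refine this.trans ?_
    gcongr _ * Real.exp (_ * ?_)
    linarith [hs.2, ht.1]

theorem exists_isIntegralCurveOn_of_bounded [CompleteSpace E] {F : ℝ × E → E} {K M : NNReal}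
    (hF : LipschitzWith K F) (hM : ∀ p, ‖F p‖ ≤ M) {a b t₀ : ℝ} (ht₀ : t₀ ∈ Icc a b) (x₀ : E) :
    ∃ x : ℝ → E, x t₀ = x₀ ∧ IsIntegralCurveOn x (fun t y => F (t, y)) (Icc a b) := by
  have hab : 0 ≤ b - a := by linarith [ht₀.1, ht₀.2]
  have : IsPicardLindelof (fun t y => F (t, y)) (⟨t₀, ht₀⟩ : Icc a b) x₀
      (M * (b - a).toNNReal) 0 M K :=
    { lipschitzOnWith := fun t _ => by
        have := hF.comp (LipschitzWith.prodMk_left t)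
        rw [mul_one] at this
        exact this.lipschitzOnWith
      continuousOn := fun y _ => by
        have := hF.continuous
        fun_prop
      norm_le := fun t _ y _ => hM _
      mul_max_le := by
        simp only [NNReal.coe_mul, Real.coe_toNNReal _ hab, NNReal.coe_zero, sub_zero]
        gcongr
        exact max_le (by linarith [ht₀.1]) (by linarith [ht₀.2]) }
  exact this.exists_eq_forall_mem_Icc_hasDerivWithinAt₀

theorem IsIntegralCurveOn.dist_le_of_bounded {F : ℝ → E → E} {M : ℝ} (hM : ∀ t y, ‖F t y‖ ≤ M)
    {x : ℝ → E} {a b : ℝ} (hx : IsIntegralCurveOn x F (Icc a b)) {s t : ℝ}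
    (hs : s ∈ Icc a b) (ht : t ∈ Icc a b) : dist (x t) (x s) ≤ M * |t - s| := by
  rw [dist_eq_norm]
  exact (convex_Icc a b).norm_image_sub_le_of_norm_hasDerivWithin_le hx (fun r _ => hM _ _) hs ht

theorem IsIntegralCurveOn.norm_sub_euler_le {F : ℝ × E → E} {K M : NNReal}
    (hF : LipschitzWith K F) (hM : ∀ p, ‖F p‖ ≤ M) {x : ℝ → E} {a b : ℝ}
    (hx : IsIntegralCurveOn x (fun t y => F (t, y)) (Icc a b)) {t h : ℝ}
    (ht : t ∈ Icc a b) (hh : 0 ≤ h) (hth : t + h ∈ Icc a b) :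
    dist (x t + h • F (t, x t)) (x (t + h)) ≤ K * (1 + M) * h ^ 2 := by
  have hsub : Icc t (t + h) ⊆ Icc a b := Icc_subset_Icc ht.1 hth.2
  have hd : ∀ r ∈ Icc t (t + h), HasDerivWithinAt (fun r => x r - r • F (t, x t))
      (F (r, x r) - F (t, x t)) (Icc t (t + h)) r := fun r hr => by
    have h1 := (hx r (hsub hr)).mono hsub
    have h2 := ((hasDerivAt_id r).smul_const (F (t, x t))).hasDerivWithinAt (s := Icc t (t + h))
    simpa [Pi.sub_def] using h1.sub h2
  have hb : ∀ r ∈ Icc t (t + h), ‖F (r, x r) - F (t, x t)‖ ≤ K * (1 + M) * h := fun r hr => by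
    rw [← dist_eq_norm]
    refine (hF.dist_le_mul _ _).trans ?_
    rw [mul_assoc]
    have h0 : |r - t| ≤ h := by rw [abs_of_nonneg (by linarith [hr.1])]; linarith [hr.2]
    have h1 := hx.dist_le_of_bounded (fun t y => hM (t, y)) ht (hsub hr)
    have h2 : (M : ℝ) * |r - t| ≤ M * h := by gcongr
    gcongr
    rw [Prod.dist_eq]
    refine max_le ?_ ?_
    · rw [Real.dist_eq]; nlinarith [M.2, abs_nonneg (r - t)]
    · dsimp only; linarith
  have := (convex_Icc t (t + h)).norm_image_sub_le_of_norm_hasDerivWithin_le hd hb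
    ⟨le_rfl, by linarith⟩ ⟨by linarith, le_rfl⟩
  rw [dist_comm, dist_eq_norm]
  have e : x (t + h) - (x t + h • F (t, x t))
      = x (t + h) - (t + h) • F (t, x t) - (x t - t • F (t, x t)) := by module
  rw [e]
  refine this.trans (le_of_eq ?_)
  rw [add_sub_cancel_left, Real.norm_of_nonneg hh]
  ring

theorem IsCompact.exists_penalty {α : Type*} [TopologicalSpace α] [T2Space α] {s : Set α}
    (hs : IsCompact s) {g D : α → ℝ} (hg : ContinuousOn g s) (hD : ContinuousOn D s)
    (hD0 : ∀ q ∈ s, 0 ≤ D q) {c : ℝ} (h : ∀ q ∈ s, D q = 0 → c < g q) :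
    ∃ N : NNReal, ∀ q ∈ s, c ≤ g q + N * D q := by
  have hs' : IsCompact (s ∩ g ⁻¹' Iic c) :=
    hs.of_isClosed_subset (hg.preimage_isClosed_of_isClosed hs.isClosed isClosed_Iic)
      inter_subset_left
  rcases (s ∩ g ⁻¹' Iic c).eq_empty_or_nonempty with he | hne
  · refine ⟨0, fun q hq => ?_⟩
    by_contra! hlt
    have : q ∈ s ∩ g ⁻¹' Iic c := ⟨hq, by simpa using hlt.le⟩
    simp [he] at this
  · obtain ⟨q₁, hq₁, hmin⟩ := hs'.exists_isMinOn hne (hD.mono inter_subset_left)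
    obtain ⟨m, hm⟩ := hs.bddBelow_image hg
    have hpos : 0 < D q₁ := (hD0 q₁ hq₁.1).lt_of_ne' fun h0 => (h q₁ hq₁.1 h0).not_ge hq₁.2
    refine ⟨((c - m) / D q₁).toNNReal, fun q hq => ?_⟩
    have hN := Real.le_coe_toNNReal ((c - m) / D q₁)
    rw [div_le_iff₀ hpos] at hN
    have hmq : m ≤ g q := hm ⟨q, hq, rfl⟩
    have h0 : (0 : ℝ) ≤ ((c - m) / D q₁).toNNReal := NNReal.coe_nonneg _
    by_cases hle : g q ≤ c
    · have : D q₁ ≤ D q := hmin ⟨hq, hle⟩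
      nlinarith
    · nlinarith [mul_nonneg h0 (hD0 q hq)]

/-- A Lipschitz function that is almost constant along trajectories (to first order), lies below
the cost `z`, and is nearly the optimal value on the initial set. -/
theorem exists_lipschitz_value [CompleteSpace E] {F : ℝ × E → E} {K M : NNReal}
    (hF : LipschitzWith K F) (hM : ∀ p, ‖F p‖ ≤ M) {a b T : ℝ} (hT : 0 ≤ T) (ha : a ≤ 0)
    (hb : T ≤ b) {Om Om0 : Set E} (hOm : IsCompact Om) (hOm0 : IsCompact Om0) (hne : Om.Nonempty)
    {z : E → ℝ} (hz : Continuous z) {P δ : ℝ} (hδ : 0 < δ)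
    (H : ∀ x : ℝ → E, x 0 ∈ Om0 → IsIntegralCurveOn x (fun t y => F (t, y)) (Icc a b) →
      ∀ t ∈ Icc 0 T, x t ∈ Om → P ≤ z (x t)) :
    ∃ (V : ℝ × E → ℝ) (L : NNReal) (C : ℝ), LipschitzWith L V ∧
      (∀ t ∈ Icc a b, ∀ h, 0 ≤ h → t + h ∈ Icc a b → ∀ y,
        V (t, y) - C * h ^ 2 ≤ V (t + h, y + h • F (t, y))) ∧
      (∀ t ∈ Icc 0 T, ∀ y ∈ Om, V (t, y) ≤ z y) ∧
      (∀ y ∈ Om0, P - δ ≤ V (0, y)) := by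
  have hab : a ≤ b := by linarith
  have hsub : Icc 0 T ⊆ Icc a b := Icc_subset_Icc ha hb
  have h0T : (0 : ℝ) ∈ Icc 0 T := ⟨le_rfl, hT⟩
  have hFt : ∀ t, LipschitzWith K fun y => F (t, y) := fun t => by
    have := hF.comp (LipschitzWith.prodMk_left t)
    rwa [mul_one] at this
  choose X hX0 hX using fun (t : Icc a b) (y : E) => exists_isIntegralCurveOn_of_bounded hF hM t.2 y
  set c := Real.exp (K * (b - a)) with hc
  have hflow : ∀ (t t' : Icc a b) (y y' : E), ∀ r ∈ Icc a b,
      dist (X t y r) (X t' y' r) ≤ dist (X t y t') y' * c := fun t t' y y' r hr => by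
    simpa only [hX0] using (hX t y).dist_le hFt (hX t' y') t'.2 hr
  obtain ⟨N, hN⟩ : ∃ N : NNReal, ∀ q ∈ (Om0 ×ˢ Icc 0 T) ×ˢ Om,
      P - δ ≤ z q.2 + N * dist (X ⟨0, hsub h0T⟩ q.1.1 q.1.2) q.2 := by
    have hXc : ContinuousOn (fun p : E × ℝ => X ⟨0, hsub h0T⟩ p.1 p.2) (Om0 ×ˢ Icc 0 T) := by
      refine continuousOn_prod_of_continuousOn_lipschitzOnWith _ c.toNNReal
        (fun y _ => (hX _ y).continuousOn.mono hsub) fun t ht => ?_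
      refine LipschitzOnWith.of_dist_le_mul fun y _ y' _ => ?_
      rw [Real.coe_toNNReal _ (Real.exp_pos _).le, mul_comm]
      have := hflow ⟨0, hsub h0T⟩ ⟨0, hsub h0T⟩ y y' t (hsub ht)
      rwa [hX0] at this
    refine ((hOm0.prod isCompact_Icc).prod hOm).exists_penalty (g := fun q => z q.2)
      (D := fun q => dist (X ⟨0, hsub h0T⟩ q.1.1 q.1.2) q.2) (by fun_prop) ?_
      (fun _ _ => dist_nonneg) fun q hq hq0 => ?_
    · have h1 : ContinuousOn (fun q : (E × ℝ) × E => X ⟨0, hsub h0T⟩ q.1.1 q.1.2)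
          ((Om0 ×ˢ Icc 0 T) ×ˢ Om) := hXc.comp continuousOn_fst fun q hq => hq.1
      exact continuous_dist.comp_continuousOn (h1.prodMk continuousOn_snd)
    · have he := dist_eq_zero.1 hq0
      have := H _ (by rw [hX0 ⟨0, hsub h0T⟩ q.1.1]; exact hq.1.1) (hX _ _) q.1.2 hq.1.2
        (by rw [he]; exact hq.2)
      rw [he] at this
      linarith
  obtain ⟨m, hm⟩ := hOm.bddBelow_image hz.continuousOn
  have : Nonempty (Icc 0 T × Om) := ⟨⟨⟨0, h0T⟩, ⟨_, hne.some_mem⟩⟩⟩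
  let cost (t : Icc a b) (y : E) (i : Icc 0 T × Om) : ℝ := z i.2 + N * dist (X t y i.1) i.2
  have hbdd : ∀ t y, BddBelow (range (cost t y)) := fun t y => by
    refine ⟨m, ?_⟩
    rintro _ ⟨i, rfl⟩
    have h1 : m ≤ z i.2 := hm ⟨_, i.2.2, rfl⟩
    have h2 : 0 ≤ N * dist (X t y i.1) i.2 := by positivity
    exact h1.trans (le_add_of_nonneg_right h2)
  let W (t : Icc a b) (y : E) : ℝ := ⨅ i, cost t y i
  have hW : ∀ t t' y y', W t y ≤ W t' y' + N * c * dist (X t y t') y' := fun t t' y y' => by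
    rw [← sub_le_iff_le_add]
    refine le_ciInf fun i => ?_
    have h1 : W t y ≤ cost t y i := ciInf_le (hbdd t y) i
    have h2 := hflow t t' y y' i.1 (hsub i.1.2)
    have h3 := dist_triangle (X t y i.1) (X t' y' i.1) i.2
    have h4 : N * dist (X t y i.1) i.2
        ≤ N * (dist (X t y t') y' * c + dist (X t' y' i.1) i.2) := by gcongr; linarith
    simp only [cost] at h1 ⊢
    linarith
  refine ⟨fun p => W (projIcc a b hab p.1) p.2, N * c.toNNReal * (1 + M),
    N * c * (K * (1 + M)), LipschitzWith.of_le_add_mul _ fun p q => ?_, fun t ht h hh hth y => ?_,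
    fun t ht y hy => ?_, fun y hy => ?_⟩
  · refine (hW _ (projIcc a b hab q.1) _ q.2).trans ?_
    have h1 := (hX (projIcc a b hab p.1) p.2).dist_le_of_bounded (fun t y => hM (t, y))
      (projIcc a b hab p.1).2 (projIcc a b hab q.1).2
    rw [hX0] at h1
    have h2 : |(projIcc a b hab q.1 : ℝ) - projIcc a b hab p.1| ≤ dist p q := by
      refine (abs_projIcc_sub_projIcc hab).trans ?_
      rw [← Real.dist_eq, dist_comm]
      exact le_max_left _ _
    have h3 : dist p.2 q.2 ≤ dist p q := le_max_right _ _
    have h4 := dist_triangle (X (projIcc a b hab p.1) p.2 (projIcc a b hab q.1)) p.2 q.2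
    have h5 : (M : ℝ) * |(projIcc a b hab q.1 : ℝ) - projIcc a b hab p.1| ≤ M * dist p q := by
      gcongr
    rw [NNReal.coe_mul, NNReal.coe_mul, NNReal.coe_add, NNReal.coe_one,
      Real.coe_toNNReal _ (Real.exp_pos _).le, mul_assoc (N * c : ℝ)]
    gcongr
    linarith
  · rw [sub_le_iff_le_add]
    dsimp only
    rw [projIcc_of_mem hab ht, projIcc_of_mem hab hth]
    refine (hW _ ⟨t + h, hth⟩ _ (y + h • F (t, y))).trans ?_
    have := (hX ⟨t, ht⟩ y).norm_sub_euler_le hF hM ht hh hth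
    rw [hX0 ⟨t, ht⟩ y, dist_comm] at this
    rw [mul_assoc (N * c : ℝ)]
    gcongr
  · have := ciInf_le (hbdd (projIcc a b hab t) y) (⟨t, ht⟩, ⟨y, hy⟩)
    refine this.trans (le_of_eq ?_)
    have h1 := hX0 ⟨t, hsub ht⟩ y
    dsimp only at h1
    simp only [cost, projIcc_of_mem hab (hsub ht), h1, dist_self, mul_zero, add_zero]
  · refine le_ciInf fun i => ?_
    rw [projIcc_of_mem hab (hsub h0T)]
    exact hN ((y, i.1), i.2) ⟨⟨hy, i.1.2⟩, i.2.2⟩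

/-- A `C¹` subsolution of the transport inequality with nearly optimal initial values. -/
theorem exists_contDiff_subsolution [FiniteDimensional ℝ E] {F : ℝ × E → E} {K M : NNReal}
    (hF : LipschitzWith K F) (hM : ∀ p, ‖F p‖ ≤ M) {T : ℝ} (hT : 0 ≤ T)
    {Om Om0 : Set E} (hOm : IsCompact Om) (hOm0 : IsCompact Om0) (hne : Om.Nonempty)
    {z : E → ℝ} (hz : Continuous z) {P δ : ℝ} (hδ : 0 < δ)
    (H : ∀ x : ℝ → E, x 0 ∈ Om0 → (∀ t ∈ Icc 0 T, HasDerivAt x (F (t, x t)) t) →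
      ∀ t ∈ Icc 0 T, x t ∈ Om → P ≤ z (x t)) :
    ∃ v : ℝ × E → ℝ, ContDiff ℝ 1 v ∧
      (∀ t ∈ Icc 0 T, ∀ y ∈ Om, v (t, y) ≤ z y) ∧
      (∀ y ∈ Om0, P - δ ≤ v (0, y)) ∧
      (∀ t ∈ Icc 0 T, ∀ y, 0 ≤ fderiv ℝ v (t, y) (1, F (t, y))) := by
  have : CompleteSpace E := FiniteDimensional.complete ℝ E
  obtain ⟨V, L, C, hL, hgrow, hVz, hV0⟩ := exists_lipschitz_value (a := -1) (b := T + 1) hF hM hT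
    (by norm_num) (by linarith) hOm hOm0 hne hz (half_pos hδ) (P := P) fun x hx0 hx => by
      refine H x hx0 fun t ht => (hx t ⟨by linarith [ht.1], by linarith [ht.2]⟩).hasDerivAt ?_
      exact Icc_mem_nhds (by linarith [ht.1]) (by linarith [ht.2])
  set e : NNReal := (δ / (4 * (T + 1))).toNNReal with he
  have heq : (e : ℝ) = δ / (4 * (T + 1)) := Real.coe_toNNReal _ (by positivity)
  have hepos : (0 : ℝ) < e := by rw [heq]; positivity
  have heT : e * T ≤ δ / 4 := by
    rw [heq, div_mul_eq_mul_div, div_le_div_iff₀ (by positivity) (by positivity)]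
    nlinarith
  have hu : LipschitzWith (L + e) fun p : ℝ × E => V p + e * p.1 := by
    refine hL.add ?_
    refine LipschitzWith.of_dist_le_mul fun p q => ?_
    rw [Real.dist_eq, ← mul_sub, abs_mul, NNReal.abs_eq, ← Real.dist_eq]
    gcongr
    exact le_max_left _ _
  have hG : LipschitzWith (max 0 K) fun p : ℝ × E => ((1 : ℝ), F p) :=
    (LipschitzWith.const 1).prodMk hF
  rw [max_eq_right (zero_le : 0 ≤ K)] at hG
  obtain ⟨η, hη, hη1, hη2, hη3⟩ : ∃ η : ℝ, 0 < η ∧ η ≤ 1 / 2 ∧ (L + e) * η ≤ δ / 8 ∧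
      (L + e) * K * η ≤ e := by
    have hA : (0 : ℝ) < L + e := by positivity
    have hB : (0 : ℝ) < (L + e) * K + 1 := by positivity
    refine ⟨min (1 / 2) (min (δ / 8 / (L + e)) (e / ((L + e) * K + 1))), by positivity,
      min_le_left _ _, ?_, ?_⟩
    · rw [← le_div_iff₀' hA]
      exact (min_le_right _ _).trans (min_le_left _ _)
    · set η := min (1 / 2 : ℝ) (min (δ / 8 / (L + e)) (e / ((L + e) * K + 1)))
      have h1 : η ≤ e / ((L + e) * K + 1) := (min_le_right _ _).trans (min_le_right _ _)
      have h2 : 0 < η := by positivity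
      rw [le_div_iff₀ hB] at h1
      linarith
  obtain ⟨w, hw, hwu, hwG⟩ := exists_contDiff_approx_of_growth hu hG hη
  push_cast at hwu hwG
  refine ⟨fun p => w p - (δ / 4 + δ / 8), hw.sub contDiff_const, fun t ht y hy => ?_,
    fun y hy => ?_, fun t ht y => ?_⟩
  · have h1 := (abs_le.1 (hwu (t, y))).2
    have h2 := hVz t ht y hy
    have h3 : e * t ≤ e * T := by gcongr; exact ht.2
    simp only at h1 ⊢
    linarith
  · have h1 := (abs_le.1 (hwu (0, y))).1
    have h2 := hV0 y hy
    simp only [mul_zero, add_zero] at h1 ⊢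
    linarith
  · rw [fderiv_sub_const]
    refine le_trans ?_ (hwG (t, y) e C (1 / 2) (by norm_num) fun q hq h hh => ?_)
    · linarith
    · have h1 : |q.1 - t| < η := by
        rw [← Real.dist_eq]
        exact (le_max_left _ _).trans_lt (Metric.mem_ball.1 hq)
      rw [abs_lt] at h1
      have := hgrow q.1 ⟨by linarith [ht.1], by linarith [ht.2]⟩ h hh.1.le
        ⟨by linarith [ht.1, hh.1], by linarith [ht.2, hh.2]⟩ q.2
      have h2 : q + h • ((1 : ℝ), F q) = (q.1 + h, q.2 + h • F (q.1, q.2)) := by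
        ext <;> simp
      rw [h2]
      simp only [Prod.mk.eta] at this ⊢
      linarith

end

/-- Truncation of a Lipschitz vector field to a bounded one. -/
theorem exists_bounded_lipschitz_truncation {n : ℕ} {f : ℝ × Vec n → Vec n} {K : NNReal}
    (hf : LipschitzWith K f) {T : ℝ} (hT : 0 ≤ T) :
    ∃ C₀ : ℝ, 0 ≤ C₀ ∧ ∀ R, 0 ≤ R → ∃ (F : ℝ × Vec n → Vec n) (M : NNReal),
      LipschitzWith K F ∧ (∀ p, ‖F p‖ ≤ M) ∧
      (∀ t ∈ Icc 0 T, ∀ x, ‖x‖ ≤ R → F (t, x) = f (t, x)) ∧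
      ∀ p, ‖F p‖ ≤ K * ‖p.2‖ + C₀ := by
  have hgrow : ∀ s ∈ Icc 0 T, ∀ y, ‖f (s, y)‖ ≤ K * ‖y‖ + (‖f 0‖ + K * T) := fun s hs y => by
    have h1 := hf.dist_le_mul (s, y) 0
    have h2 : dist (s, y) 0 ≤ T + ‖y‖ := by
      rw [dist_zero_right, Prod.norm_def]
      refine max_le ?_ ?_
      · rw [Real.norm_of_nonneg hs.1]
        linarith [hs.2, norm_nonneg y]
      · dsimp only
        linarith
    have h3 : K * dist (s, y) 0 ≤ K * (T + ‖y‖) := by gcongr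
    have h4 := norm_le_norm_add_norm_sub' (f (s, y)) (f 0)
    rw [← dist_eq_norm] at h4
    linarith
  refine ⟨‖f 0‖ + K * T, by positivity, fun R hR => ?_⟩
  have hRR : -R ≤ R := by linarith
  let r (x : Vec n) : Vec n := WithLp.toLp 2 fun i => (projIcc (-R) R hRR (x i) : ℝ)
  have hr : LipschitzWith 1 r := LipschitzWith.of_dist_le_mul fun x y => by
    rw [NNReal.coe_one, one_mul, EuclideanSpace.dist_eq, EuclideanSpace.dist_eq]
    refine Real.sqrt_le_sqrt (Finset.sum_le_sum fun i _ => ?_)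
    refine pow_le_pow_left₀ dist_nonneg ?_ 2
    exact abs_projIcc_sub_projIcc hRR
  have hr0 : r 0 = 0 := by
    ext i
    simp [r, projIcc_of_mem hRR (show (0 : ℝ) ∈ Icc (-R) R from ⟨by linarith, hR⟩)]
  have hrle : ∀ x, ‖r x‖ ≤ ‖x‖ := fun x => by simpa [hr0] using hr.dist_le_mul x 0
  have hrR : ∀ x, ‖r x‖ ≤ √(n * R ^ 2) := fun x => by
    rw [EuclideanSpace.norm_eq]
    refine Real.sqrt_le_sqrt ?_
    calc ∑ i, ‖r x i‖ ^ 2 ≤ ∑ _i : Fin n, R ^ 2 := Finset.sum_le_sum fun i _ =>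
          pow_le_pow_left₀ (norm_nonneg _) (abs_le.2 (projIcc (-R) R hRR (x i)).2) 2
      _ = n * R ^ 2 := by simp
  have hrid : ∀ x, ‖x‖ ≤ R → r x = x := fun x hx => by
    ext i
    have : x i ∈ Icc (-R) R := abs_le.1 ((PiLp.norm_apply_le x i).trans hx)
    simp only [r, projIcc_of_mem hRR this]
  have hclock : LipschitzWith 1 fun t : ℝ => (projIcc 0 T hT t : ℝ) :=
    LipschitzWith.of_dist_le_mul fun s t => by
      rw [NNReal.coe_one, one_mul]
      exact abs_projIcc_sub_projIcc hT
  refine ⟨fun p => f (projIcc 0 T hT p.1, r p.2),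
    (K * √(n * R ^ 2) + (‖f 0‖ + K * T)).toNNReal, ?_, fun p => ?_, fun t ht x hx => ?_,
    fun p => ?_⟩
  · have := hf.comp ((hclock.comp LipschitzWith.prod_fst).prodMk (hr.comp LipschitzWith.prod_snd))
    simpa [Function.comp_def] using this
  · refine le_trans ?_ (Real.le_coe_toNNReal _)
    refine (hgrow _ (projIcc 0 T hT p.1).2 _).trans ?_
    gcongr
    exact hrR _
  · simp only [projIcc_of_mem hT ht, hrid x hx]
  · refine (hgrow _ (projIcc 0 T hT p.1).2 _).trans ?_
    gcongr
    exact hrle _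

theorem exists_contDiff_subsolution_of_lipschitz {n : ℕ} {f : ℝ × Vec n → Vec n} {K : NNReal}
    (hf : LipschitzWith K f) {T : ℝ} (hT : 0 ≤ T)
    {Om Om0 : Set (Vec n)} (hOm : IsCompact Om) (hOm0 : IsCompact Om0) (hne : Om.Nonempty)
    {z : Vec n → ℝ} (hz : Continuous z) {P δ : ℝ} (hδ : 0 < δ)
    (H : ∀ x : ℝ → Vec n, x 0 ∈ Om0 → (∀ t ∈ Icc 0 T, HasDerivAt x (f (t, x t)) t) →
      ∀ t ∈ Icc 0 T, x t ∈ Om → P ≤ z (x t)) :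
    ∃ v : ℝ × Vec n → ℝ, ContDiff ℝ 1 v ∧
      (∀ t ∈ Icc 0 T, ∀ y ∈ Om, v (t, y) ≤ z y) ∧
      (∀ y ∈ Om0, P - δ ≤ v (0, y)) ∧
      (∀ t ∈ Icc 0 T, ∀ y ∈ Om, 0 ≤ fderiv ℝ v (t, y) (1, f (t, y))) := by
  obtain ⟨C₀, hC₀, htrunc⟩ := exists_bounded_lipschitz_truncation hf hT
  obtain ⟨r, hr, hrb⟩ := (hOm.union hOm0).isBounded.exists_pos_norm_le
  obtain ⟨F, M, hF, hM, hFf, hFg⟩ := htrunc (max r (gronwallBound r K C₀ T))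
    (hr.le.trans (le_max_left _ _))
  obtain ⟨v, hv, hvz, hv0, hvF⟩ := exists_contDiff_subsolution hF hM hT hOm hOm0 hne hz hδ
    (P := P) fun x hx0 hx => by
      refine H x hx0 fun t ht => ?_
      have h1 := norm_le_gronwallBound_of_norm_deriv_right_le (a := 0) (b := T)
        (fun t ht => (hx t ht).continuousAt.continuousWithinAt)
        (fun t ht => (hx t (Ico_subset_Icc_self ht)).hasDerivWithinAt) (hrb _ (Or.inr hx0))
        (fun t _ => hFg (t, x t)) t ht
      rw [← hFf t ht (x t)]
      · exact hx t ht
      · refine h1.trans (le_trans ?_ (le_max_right _ _))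
        rw [sub_zero]
        exact gronwallBound_mono hr.le hC₀ K.2 ht.2
  refine ⟨v, hv, hvz, hv0, fun t ht y hy => ?_⟩
  rw [← hFf t ht y ((hrb y (Or.inl hy)).trans (le_max_left _ _))]
  exact hvF t ht y

/-- If a curve cannot come back after touching the boundary, then it has stayed inside up to any
time at which it is inside. -/
theorem mem_of_mem_of_nonreturn {α : Type*} [TopologicalSpace α] {s : Set α} (hs : IsClosed s)
    {x : ℝ → α} {T : ℝ} (hx : ContinuousOn x (Icc 0 T)) (hx0 : x 0 ∈ s)
    (hret : ∀ t ∈ Icc 0 T, x t ∈ frontier s → ∀ t' ∈ Ioc t T, x t' ∉ s)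
    {τ : ℝ} (hτ : τ ∈ Icc 0 T) (hxτ : x τ ∈ s) : ∀ t ∈ Icc 0 τ, x t ∈ s := by
  intro t ht
  by_contra hxt
  have hsub : Icc 0 t ⊆ Icc 0 T := Icc_subset_Icc le_rfl (ht.2.trans hτ.2)
  have hxt' : ContinuousOn x (Icc 0 t) := hx.mono hsub
  have hcpt : IsCompact (Icc 0 t ∩ x ⁻¹' s) :=
    isCompact_Icc.of_isClosed_subset (hxt'.preimage_isClosed_of_isClosed isClosed_Icc hs)
      inter_subset_left
  obtain ⟨r, ⟨hr, hrs⟩, hmax⟩ := hcpt.exists_isGreatest ⟨0, ⟨le_rfl, ht.1⟩, hx0⟩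
  have hrt : r < t := hr.2.lt_of_ne fun h => hxt (h ▸ hrs)
  refine hret r (hsub hr) ⟨subset_closure hrs, fun hint => ?_⟩ τ ⟨hrt.trans_le ht.2, hτ.2⟩ hxτ
  have h1 : ∀ᶠ r' in nhdsWithin r (Icc 0 t), x r' ∈ s :=
    (hxt' r hr).eventually (mem_interior_iff_mem_nhds.1 hint)
  have h2 : ∀ᶠ r' in nhdsWithin r (Ioi r), r' ∈ Ioo r t := Ioo_mem_nhdsGT hrt
  have h3 : ∀ᶠ r' in nhdsWithin r (Ioi r), x r' ∈ s :=
    h1.filter_mono <| nhdsWithin_le_of_mem <| Filter.mem_of_superset (Ioo_mem_nhdsGT hrt)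
      fun r' h => mem_Icc.2 ⟨hr.1.trans h.1.le, h.2.le⟩
  obtain ⟨r', hr's, hr'⟩ := (h3.and h2).exists
  exact (hmax ⟨⟨hr.1.trans hr'.1.le, hr'.2.le⟩, hr's⟩).not_gt hr'.1

section

variable {nw ns n : ℕ} {T : ℝ} {Om Om0 : Set (Vec nw)} {S : Set (Vec ns)} {X Xu : Set (Vec n)}
  {A : Vec ns × Vec nw → Vec n} {f : ℝ × Vec nw → Vec nw} {c : Vec n × Vec n → ℝ}

/-- Weak duality along an admissible trajectory. -/
theorem ShapeDualFeasible.le_cost (hmaps : ∀ s ∈ S, ∀ om ∈ Om, A (s, om) ∈ X) {γ : ℝ}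
    {v : ℝ × Vec nw → ℝ} {w : Vec n → ℝ} {z : Vec nw → ℝ}
    (h : ShapeDualFeasible T Om Om0 S X Xu A f c γ v w z) {om : ℝ → Vec nw} {tp : ℝ}
    (hom : ShapeAdmissible T Om Om0 f om tp) {s : Vec ns} (hs : s ∈ S) {y : Vec n} (hy : y ∈ Xu) :
    γ ≤ c (A (s, om tp), y) := by
  obtain ⟨hv, -, -, hγ, hw, hzw, hvz, hLie⟩ := h
  obtain ⟨htp, h0, hd, hin⟩ := hom
  have hder : ∀ t ∈ Icc 0 tp, HasDerivAt (fun t => v (t, om t)) (LieD f v (t, om t)) t :=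
    fun t ht => (((hv.differentiable one_ne_zero) _).hasFDerivAt).comp_hasDerivAt t
      ((hasDerivAt_id t).prodMk (hd t ht))
  have hmono : MonotoneOn (fun t => v (t, om t)) (Icc 0 tp) := by
    refine monotoneOn_of_hasDerivWithinAt_nonneg (convex_Icc 0 tp)
      (fun t ht => (hder t ht).continuousAt.continuousWithinAt)
      (fun t ht => (hder t (interior_subset ht)).hasDerivWithinAt) fun t ht => ?_
    have ht' := interior_subset ht
    exact hLie t ⟨ht'.1, ht'.2.trans htp.2⟩ _ (hin t ht')
  have htp' : tp ∈ Icc 0 tp := ⟨htp.1, le_rfl⟩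
  calc γ ≤ v (0, om 0) := hγ _ h0
    _ ≤ v (tp, om tp) := hmono ⟨le_rfl, htp.1⟩ htp' htp.1
    _ ≤ z (om tp) := hvz _ htp _ (hin tp htp')
    _ ≤ w (A (s, om tp)) := hzw s hs _ (hin tp htp')
    _ ≤ c (A (s, om tp), y) := hw _ (hmaps s hs _ (hin tp htp')) y hy

theorem exists_shapeAdmissible (hT : 0 ≤ T) (hOm0Om : Om0 ⊆ Om) (h0 : Om0.Nonempty) :
    ∃ om, ShapeAdmissible T Om Om0 f om 0 := by
  obtain ⟨y, hy⟩ := h0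
  refine ⟨fun t => y + t • f (0, y), ⟨le_rfl, hT⟩, by simpa, fun t ht => ?_, fun t ht => ?_⟩
  · obtain rfl : t = 0 := by simpa using ht
    simpa using ((hasDerivAt_id (0 : ℝ)).smul_const (f (0, y))).const_add y
  · obtain rfl : t = 0 := by simpa using ht
    simpa using hOm0Om hy

/-- If there is nothing to be compared, every value is dual feasible. -/
theorem exists_shapeDualFeasible_of_empty (hX : IsCompact X) (hXu : IsCompact Xu)
    (hc : ContinuousOn c (X ×ˢ Xu)) (he : Om0 = ∅ ∨ S = ∅ ∨ Xu = ∅) (γ : ℝ) :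
    ∃ v w z, ShapeDualFeasible T Om Om0 S X Xu A f c γ v w z := by
  obtain ⟨m, hm⟩ := (hX.prod hXu).bddBelow_image hc
  have hm' : ∀ x ∈ X, ∀ y ∈ Xu, m ≤ c (x, y) := fun x hx y hy => hm ⟨(x, y), ⟨hx, hy⟩, rfl⟩
  rcases he with rfl | rfl | rfl
  · exact ⟨fun _ => m, fun _ => m, fun _ => m, contDiff_const, continuous_const, continuous_const,
      by simp, hm', by simp, by simp, by simp [LieD]⟩
  · exact ⟨fun _ => γ, fun _ => m, fun _ => γ, contDiff_const, continuous_const, continuous_const,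
      by simp, hm', by simp, by simp, by simp [LieD]⟩
  · exact ⟨fun _ => γ, fun _ => γ, fun _ => γ, contDiff_const, continuous_const, continuous_const,
      by simp, by simp, by simp, by simp, by simp [LieD]⟩

/-- Continuous minorants `w`, `z` of the cost such that `z` is attained by the shape. -/
theorem exists_shape_cost (hS : IsCompact S) (hX : IsCompact X) (hXu : IsCompact Xu)
    (hSne : S.Nonempty) (hXune : Xu.Nonempty) (hA : Continuous A)
    (hmaps : ∀ s ∈ S, ∀ om ∈ Om, A (s, om) ∈ X) (hc : ContinuousOn c (X ×ˢ Xu)) :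
    ∃ (w : Vec n → ℝ) (z : Vec nw → ℝ), Continuous w ∧ Continuous z ∧
      (∀ x ∈ X, ∀ y ∈ Xu, w x ≤ c (x, y)) ∧ (∀ s ∈ S, ∀ om, z om ≤ w (A (s, om))) ∧
      ∀ om ∈ Om, ∃ s ∈ S, ∃ y ∈ Xu, z om = c (A (s, om), y) := by
  obtain ⟨g, hg⟩ := ContinuousMap.exists_restrict_eq (hX.prod hXu).isClosed
    ⟨_, continuousOn_iff_continuous_domRestrict.1 hc⟩
  have hgc : ∀ x ∈ X, ∀ y ∈ Xu, g (x, y) = c (x, y) := fun x hx y hy =>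
    DFunLike.congr_fun hg ⟨(x, y), hx, hy⟩
  have hw : Continuous fun x => sInf ((fun y => g (x, y)) '' Xu) :=
    hXu.continuous_sInf (f := fun x y => g (x, y)) (map_continuous g)
  set w : Vec n → ℝ := fun x => sInf ((fun y => g (x, y)) '' Xu)
  have hcg : ∀ x, ContinuousOn (fun y => g (x, y)) Xu := fun x => by fun_prop
  have hcw : ∀ om, ContinuousOn (fun s => w (A (s, om))) S := fun om => by fun_prop
  refine ⟨w, fun om => sInf ((fun s => w (A (s, om))) '' S), hw,
    hS.continuous_sInf (f := fun om s => w (A (s, om)))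
      (hw.comp (hA.comp continuous_swap)), fun x hx y hy => ?_, fun s hs om => ?_,
    fun om hom => ?_⟩
  · rw [← hgc x hx y hy]
    exact csInf_le (hXu.bddBelow_image (hcg x)) ⟨y, hy, rfl⟩
  · exact csInf_le (hS.bddBelow_image (hcw om)) ⟨s, hs, rfl⟩
  · obtain ⟨s, hs, hseq⟩ := (hS.image_of_continuousOn (hcw om)).sInf_mem (hSne.image _)
    obtain ⟨y, hy, hyeq⟩ :=
      (hXu.image_of_continuousOn (hcg (A (s, om)))).sInf_mem (hXune.image _)
    exact ⟨s, hs, y, hy, by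
      rw [← hgc _ (hmaps s hs om hom) y hy]; exact hseq.symm.trans hyeq.symm⟩

theorem shape_delta_optimality_of_empty (hX : IsCompact X) (hXu : IsCompact Xu)
    (hc : ContinuousOn c (X ×ˢ Xu)) (he : Om0 = ∅ ∨ S = ∅ ∨ Xu = ∅) :
    (∀ δ : ℝ, 0 < δ →
      ∃ (γ : ℝ) (v : ℝ × Vec nw → ℝ) (w : Vec n → ℝ) (z : Vec nw → ℝ),
        ShapeDualFeasible T Om Om0 S X Xu A f c γ v w z ∧
        ShapePStar T Om Om0 S Xu A f c - δ ≤ γ ∧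
        γ ≤ ShapePStar T Om Om0 S Xu A f c) ∧
    sSup {γ | ∃ v w z, ShapeDualFeasible T Om Om0 S X Xu A f c γ v w z} =
      ShapePStar T Om Om0 S Xu A f c := by
  have hfeas := exists_shapeDualFeasible_of_empty (T := T) (Om := Om) (A := A) (f := f) hX hXu hc he
  refine ⟨fun δ hδ => ?_, ?_⟩
  · obtain ⟨v, w, z, h⟩ := hfeas (ShapePStar T Om Om0 S Xu A f c)
    exact ⟨_, v, w, z, h, by linarith, le_rfl⟩
  · have h1 : {γ | ∃ v w z, ShapeDualFeasible T Om Om0 S X Xu A f c γ v w z} = univ :=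
      eq_univ_of_forall hfeas
    have h2 : ShapePStar T Om Om0 S Xu A f c = 0 := by
      rw [ShapePStar, ← Real.sInf_empty]
      congr 1
      refine eq_empty_of_forall_notMem ?_
      rintro _ ⟨om, tp, s, y, hom, hs, hy, -⟩
      rcases he with rfl | rfl | rfl
      exacts [hom.2.1, hs, hy]
    rw [h1, h2, Real.sSup_univ]

end

/-- δ-optimality of the shape function program.  Under compactness,
Lipschitz dynamics, continuity of `A` and `c`, and the non-return assumptions, for
every `δ > 0` there is a shape-dual-feasible quadruple with `P* − δ ≤ γ ≤ P*`; in
particular the shape function-program value `d*` equals `P*`. -/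
theorem shape_delta_optimality {nw ns n : ℕ} (T : ℝ) (hT : 0 < T)
    (Om Om0 : Set (Vec nw)) (S : Set (Vec ns)) (X Xu : Set (Vec n))
    (hOm : IsCompact Om) (hOm0 : IsCompact Om0) (hS : IsCompact S)
    (hX : IsCompact X) (hXu : IsCompact Xu) (hOm0Om : Om0 ⊆ Om) (hXuX : Xu ⊆ X)
    (A : Vec ns × Vec nw → Vec n) (hA : Continuous A)
    (hmaps : ∀ s ∈ S, ∀ om ∈ Om, A (s, om) ∈ X)
    (f : ℝ × Vec nw → Vec nw) (K : NNReal) (hf : LipschitzWith K f)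
    (c : Vec n × Vec n → ℝ) (hc : ContinuousOn c (X ×ˢ Xu))
    (hA5 : ∀ om : ℝ → Vec nw, om 0 ∈ Om0 →
      (∀ t ∈ Icc (0 : ℝ) T, HasDerivAt om (f (t, om t)) t) →
      ∀ t ∈ Icc (0 : ℝ) T, om t ∈ frontier Om → ∀ t' ∈ Ioc t T, om t' ∉ Om)
    (hA6 : ∀ om : ℝ → Vec nw, om 0 ∈ Om0 →
      (∀ t ∈ Icc (0 : ℝ) T, HasDerivAt om (f (t, om t)) t) →
      ∀ t ∈ Icc (0 : ℝ) T, ∀ s ∈ S, (A (s, om t) ∉ X ∨ A (s, om t) ∈ frontier X) →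
      ∀ t' ∈ Ioc t T, A (s, om t') ∉ X) :
    (∀ δ : ℝ, 0 < δ →
      ∃ (γ : ℝ) (v : ℝ × Vec nw → ℝ) (w : Vec n → ℝ) (z : Vec nw → ℝ),
        ShapeDualFeasible T Om Om0 S X Xu A f c γ v w z ∧
        ShapePStar T Om Om0 S Xu A f c - δ ≤ γ ∧
        γ ≤ ShapePStar T Om Om0 S Xu A f c) ∧
    sSup {γ | ∃ v w z, ShapeDualFeasible T Om Om0 S X Xu A f c γ v w z} =
      ShapePStar T Om Om0 S Xu A f c := by
  rcases eq_or_ne Om0 ∅ with h | hOm0ne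
  · exact shape_delta_optimality_of_empty hX hXu hc (Or.inl h)
  rcases eq_or_ne S ∅ with h | hSne
  · exact shape_delta_optimality_of_empty hX hXu hc (Or.inr (Or.inl h))
  rcases eq_or_ne Xu ∅ with h | hXune
  · exact shape_delta_optimality_of_empty hX hXu hc (Or.inr (Or.inr h))
  rw [← nonempty_iff_ne_empty] at hOm0ne hSne hXune
  obtain ⟨om₀, hom₀⟩ := exists_shapeAdmissible (f := f) hT.le hOm0Om hOm0ne
  have hle : ∀ γ v w z, ShapeDualFeasible T Om Om0 S X Xu A f c γ v w z →
      γ ≤ ShapePStar T Om Om0 S Xu A f c := by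
    intro γ v w z h
    refine le_csInf ⟨_, om₀, 0, _, _, hom₀, hSne.some_mem, hXune.some_mem, rfl⟩ ?_
    rintro _ ⟨om, tp, s, y, hom, hs, hy, rfl⟩
    exact h.le_cost hmaps hom hs hy
  have hδ : ∀ δ : ℝ, 0 < δ → ∃ v w z,
      ShapeDualFeasible T Om Om0 S X Xu A f c (ShapePStar T Om Om0 S Xu A f c - δ) v w z := by
    intro δ hδ
    obtain ⟨w, z, hw, hz, hwc, hzw, hzc⟩ := exists_shape_cost hS hX hXu hSne hXune hA hmaps hc
    obtain ⟨m, hm⟩ := (hX.prod hXu).bddBelow_image hc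
    obtain ⟨v, hv, hvz, hv0, hvf⟩ := exists_contDiff_subsolution_of_lipschitz hf hT.le hOm hOm0
      (hOm0ne.mono hOm0Om) hz hδ (P := ShapePStar T Om Om0 S Xu A f c) fun om h0 hd t ht htm => by
        have hin := mem_of_mem_of_nonreturn hOm.isClosed
          (fun t ht => (hd t ht).continuousAt.continuousWithinAt) (hOm0Om h0) (hA5 om h0 hd) ht htm
        obtain ⟨s, hs, y, hy, hzeq⟩ := hzc _ htm
        refine csInf_le ⟨m, ?_⟩ ⟨om, t, s, y,
          ⟨ht, h0, fun r hr => hd r ⟨hr.1, hr.2.trans ht.2⟩, hin⟩, hs, hy, hzeq⟩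
        rintro _ ⟨om, tp, s, y, hom, hs, hy, rfl⟩
        exact hm ⟨_, ⟨hmaps s hs _ (hom.2.2.2 tp ⟨hom.1.1, le_rfl⟩), hy⟩, rfl⟩
    exact ⟨v, w, z, hv, hw, hz, hv0, hwc, fun s hs om _ => hzw s hs om, hvz, hvf⟩
  refine ⟨fun δ hδ0 => ?_, ?_⟩
  · obtain ⟨v, w, z, h⟩ := hδ δ hδ0
    exact ⟨_, v, w, z, h, le_rfl, by linarith⟩
  · refine csSup_eq_of_forall_le_of_forall_lt_exists_gt ⟨_, hδ 1 one_pos⟩ ?_ fun r hr => ?_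
    · rintro γ ⟨v, w, z, h⟩
      exact hle γ v w z h
    · refine ⟨_, hδ ((ShapePStar T Om Om0 S Xu A f c - r) / 2) (by linarith), by linarith⟩
end
end

section
/- Polynomial near-optimal certificates for the shape program: Under the assumptions that [0,T], Ω, Ω₀ ⊆ Ω, S, X, X_u ⊆ X are compact, f is Lipschitz in each argument, c is continuous on X × X_u, A : S × Ω → X is continuous, and the non-return properties hold for the orientation state and the shape image, for every δ > 0 there exist a real γ and polynomials w ∈ ℝ[x], z ∈ ℝ[ω], v ∈ ℝ[t,ω] such that (γ, v, w, z) is shape-dual-feasible and P* − δ ≤ γ ≤ P*, where P* is the shape minimal distance. -/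
open MeasureTheory Set

noncomputable section

section Auxiliary

open Metric Filter Topology
open scoped NNReal

/-- Coordinatewise truncation of a vector to the cube `[-R, R]ⁿ`. -/
def cubeClamp {n : ℕ} (R : ℝ) (y : Vec n) : Vec n :=
  WithLp.toLp 2 fun i => max (-R) (min R (y i))

lemma lipschitzWith_cubeClamp {n : ℕ} (R : ℝ) : LipschitzWith 1 (cubeClamp (n := n) R) := by
  refine LipschitzWith.of_dist_le_mul fun x y => ?_
  rw [NNReal.coe_one, one_mul, EuclideanSpace.dist_eq, EuclideanSpace.dist_eq]
  refine Real.sqrt_le_sqrt (Finset.sum_le_sum fun i _ => ?_)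
  gcongr
  simp only [cubeClamp, Real.dist_eq]
  grind

lemma cubeClamp_eq_self {n : ℕ} {R : ℝ} {y : Vec n} (hy : ‖y‖ ≤ R) : cubeClamp R y = y := by
  ext i
  have h := abs_le.1 ((Real.norm_eq_abs _ ▸ PiLp.norm_apply_le y i).trans hy)
  simp only [cubeClamp]
  grind

lemma norm_cubeClamp_le {n : ℕ} {R : ℝ} (hR : 0 ≤ R) (y : Vec n) : ‖cubeClamp R y‖ ≤ ‖y‖ := by
  have h0 : cubeClamp R (0 : Vec n) = 0 := cubeClamp_eq_self (by simpa using hR)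
  simpa [h0] using (lipschitzWith_cubeClamp R).dist_le_mul y 0

lemma norm_cubeClamp_le_bound {n : ℕ} {R : ℝ} (hR : 0 ≤ R) (y : Vec n) :
    ‖cubeClamp R y‖ ≤ √(n * R ^ 2) := by
  rw [EuclideanSpace.norm_eq]
  refine Real.sqrt_le_sqrt ?_
  calc ∑ i, ‖cubeClamp R y i‖ ^ 2 ≤ ∑ _i : Fin n, R ^ 2 := by
        refine Finset.sum_le_sum fun i _ => ?_
        gcongr
        simp only [cubeClamp, Real.norm_eq_abs]
        grind
    _ = n * R ^ 2 := by simp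

/-- Grönwall bound, in both time directions, for a curve whose speed grows at most linearly. -/
lemma norm_le_gronwallBound_of_symm_Icc {E : Type*} [NormedAddCommGroup E] [NormedSpace ℝ E]
    {α α' : ℝ → E} {τ K C r : ℝ} (hK : 0 ≤ K) (hC : 0 ≤ C) (hr : 0 ≤ r)
    (hα : ∀ t ∈ Icc (-τ) τ, HasDerivWithinAt α (α' t) (Icc (-τ) τ) t)
    (hb : ∀ t ∈ Icc (-τ) τ, ‖α' t‖ ≤ K * ‖α t‖ + C) (h0 : ‖α 0‖ ≤ r) :
    ∀ t ∈ Icc (-τ) τ, ‖α t‖ ≤ gronwallBound r K C τ := by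
  have key : ∀ (β β' : ℝ → E), (∀ t ∈ Icc (-τ) τ, HasDerivWithinAt β (β' t) (Icc (-τ) τ) t) →
      (∀ t ∈ Icc (-τ) τ, ‖β' t‖ ≤ K * ‖β t‖ + C) → ‖β 0‖ ≤ r →
      ∀ t ∈ Icc 0 τ, ‖β t‖ ≤ gronwallBound r K C τ := by
    intro β β' hβ hb h0 t ht
    have hsub : Icc 0 τ ⊆ Icc (-τ) τ := Icc_subset_Icc_left (by linarith [ht.1.trans ht.2])
    have h := norm_le_gronwallBound_of_norm_deriv_right_le (f := β) (f' := β') (a := 0) (b := τ)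
      (fun s hs => ((hβ s (hsub hs)).continuousWithinAt).mono hsub)
      (fun s hs => ((hβ s (hsub (Ico_subset_Icc_self hs))).mono hsub).mono_of_mem_nhdsWithin
        (mem_of_superset (Icc_mem_nhdsGE hs.2) (Icc_subset_Icc_left hs.1)))
      h0 (fun s hs => hb s (hsub (Ico_subset_Icc_self hs))) t ht
    exact h.trans (gronwallBound_mono hr hC hK (by linarith [ht.2]))
  intro t ht
  rcases le_total 0 t with h | h
  · exact key α α' hα hb h0 t ⟨h, ht.2⟩
  · have hneg : ∀ s ∈ Icc (-τ) τ, -s ∈ Icc (-τ) τ := fun s hs =>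
      ⟨by linarith [hs.2], by linarith [hs.1]⟩
    have := key (fun s => α (-s)) (fun s => -α' (-s)) (fun s hs => by
        simpa [Function.comp_def] using
          (hα (-s) (hneg s hs)).scomp s (hasDerivAt_neg s).hasDerivWithinAt hneg)
      (fun s hs => by simpa using hb (-s) (hneg s hs)) (by simpa using h0) (-t)
      ⟨by linarith, by linarith [ht.1]⟩
    simpa using this

/-- A globally Lipschitz vector field has a flow on any symmetric time interval, which is bounded
and Lipschitz in the initial condition, for initial conditions in a ball. -/
lemma exists_flow_of_lipschitzWith {n : ℕ} {f : ℝ × Vec n → Vec n} {K : ℝ≥0}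
    (hf : LipschitzWith K f) (r : ℝ≥0) {τ : ℝ} (hτ : 0 ≤ τ) :
    ∃ α : Vec n → ℝ → Vec n,
      (∀ x ∈ closedBall (0 : Vec n) r, α x 0 = x ∧
        ∀ t ∈ Icc (-τ) τ, HasDerivAt (α x) (f (t, α x t)) t) ∧
      (∃ L : ℝ≥0, ∀ t ∈ Icc (-τ) τ, LipschitzOnWith L (α · t) (closedBall 0 r)) ∧
      ∃ B : ℝ, ∀ x ∈ closedBall (0 : Vec n) r, ∀ t ∈ Icc (-τ) τ, ‖α x t‖ ≤ B := by
  set σ := τ + 1 with hσ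
  have hσ0 : 0 ≤ σ := by linarith
  set C : ℝ := ‖f (0, 0)‖ + K * σ with hC
  have hC0 : 0 ≤ C := by positivity
  have hlin : ∀ t ∈ Icc (-σ) σ, ∀ x, ‖f (t, x)‖ ≤ K * ‖x‖ + C := by
    intro t ht x
    have h1 := hf.dist_le_mul (t, x) (0, 0)
    have h2 : dist (t, x) ((0 : ℝ), (0 : Vec n)) ≤ σ + ‖x‖ := by
      rw [Prod.dist_eq, dist_zero_right, dist_zero_right, Real.norm_eq_abs]
      exact max_le (by linarith [abs_le.2 ht, norm_nonneg x]) (by linarith)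
    have h3 : ‖f (t, x)‖ ≤ dist (f (t, x)) (f (0, 0)) + ‖f (0, 0)‖ := by
      rw [dist_eq_norm]; exact norm_le_norm_sub_add _ _
    have h4 : (K : ℝ) * dist (t, x) ((0 : ℝ), (0 : Vec n)) ≤ K * (σ + ‖x‖) := by gcongr
    rw [hC]; linarith
  set B := gronwallBound r K C σ with hB
  have hB0 : 0 ≤ B := by
    have := gronwallBound_mono (δ := (r : ℝ)) (K := K) r.2 hC0 K.2 hσ0
    rw [gronwallBound_x0] at this
    exact r.2.trans this
  set R : ℝ := K * B + C with hR
  have hR0 : 0 ≤ R := by positivity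
  set L : ℝ≥0 := ⟨√(n * R ^ 2), Real.sqrt_nonneg _⟩ with hL
  have hpl : IsPicardLindelof (fun t x => cubeClamp R (f (t, x))) (tmin := -σ) (tmax := σ)
      ⟨0, by linarith, hσ0⟩ (0 : Vec n) (L * ⟨σ, hσ0⟩ + r) r L K :=
    { lipschitzOnWith := fun t _ => by
        have := (lipschitzWith_cubeClamp (n := n) R).comp (hf.comp (LipschitzWith.prodMk_left t))
        rw [one_mul, mul_one] at this
        exact this.lipschitzOnWith
      continuousOn := fun x _ => by
        refine Continuous.continuousOn ?_
        exact (lipschitzWith_cubeClamp R).continuous.comp (hf.continuous.comp (by fun_prop))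
      norm_le := fun t _ x _ => norm_cubeClamp_le_bound hR0 _
      mul_max_le := by
        simp only [sub_zero, zero_sub, neg_neg, max_self, NNReal.coe_add,
          add_sub_cancel_right]
        exact le_rfl }
  obtain ⟨α, hα, L', hL'⟩ := hpl.exists_forall_mem_closedBall_eq_hasDerivWithinAt_lipschitzOnWith
  have hbd : ∀ x ∈ closedBall (0 : Vec n) r, ∀ t ∈ Icc (-σ) σ, ‖α x t‖ ≤ B := by
    intro x hx
    refine norm_le_gronwallBound_of_symm_Icc K.2 hC0 r.2 (hα x hx).2 (fun t ht => ?_) ?_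
    · exact (norm_cubeClamp_le hR0 _).trans (hlin t ht _)
    · have := (hα x hx).1
      simp only at this
      rw [this]; simpa using hx
  have hsub : Icc (-τ) τ ⊆ Icc (-σ) σ := Icc_subset_Icc (by linarith) (by linarith)
  refine ⟨α, fun x hx => ⟨(hα x hx).1, fun t ht => ?_⟩, ⟨L', fun t ht => hL' t (hsub ht)⟩, B,
    fun x hx t ht => hbd x hx t (hsub ht)⟩
  have h := ((hα x hx).2 t (hsub ht)).hasDerivAt
    (Icc_mem_nhds (by linarith [ht.1]) (by linarith [ht.2]))
  rwa [cubeClamp_eq_self] at h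
  refine (hlin t (hsub ht) _).trans ?_
  have := hbd x hx t (hsub ht)
  rw [hR]; gcongr

lemma abs_exp_sub_exp_le {a b m : ℝ} (ha : a ≤ m) (hb : b ≤ m) :
    |Real.exp a - Real.exp b| ≤ Real.exp m * |a - b| := by
  wlog hab : b ≤ a generalizing a b
  · rw [abs_sub_comm, abs_sub_comm a b]
    exact this hb ha (le_of_not_ge hab)
  rw [abs_of_nonneg (sub_nonneg.2 (Real.exp_le_exp.2 hab)), abs_of_nonneg (sub_nonneg.2 hab)]
  have h1 : Real.exp b = Real.exp a * Real.exp (b - a) := by rw [← Real.exp_add]; ring_nf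
  have h2 := Real.add_one_le_exp (b - a)
  have h3 := Real.exp_le_exp.2 ha
  calc Real.exp a - Real.exp b = Real.exp a * (1 - Real.exp (b - a)) := by rw [h1]; ring
    _ ≤ Real.exp a * (a - b) := mul_le_mul_of_nonneg_left (by linarith) (Real.exp_pos a).le
    _ ≤ Real.exp m * (a - b) := mul_le_mul_of_nonneg_right h3 (by linarith)

/-- First-order Taylor estimate for a solution of `ẋ = f(t, x)` of speed at most `M`. -/
lemma norm_sub_sub_smul_le_of_hasDerivAt {n : ℕ} {f : ℝ × Vec n → Vec n} {K : ℝ≥0}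
    (hf : LipschitzWith K f) {β : ℝ → Vec n} {a b M : ℝ} (hM : 0 ≤ M)
    (hβ : ∀ t ∈ Icc a b, HasDerivAt β (f (t, β t)) t)
    (hlip : ∀ s ∈ Icc a b, ∀ t ∈ Icc a b, ‖β s - β t‖ ≤ M * |s - t|)
    {t h : ℝ} (hh : 0 ≤ h) (hat : a ≤ t) (htb : t + h ≤ b) :
    ‖β (t + h) - β t - h • f (t, β t)‖ ≤ K * (1 + M) * h * h := by
  have hsub : Icc t (t + h) ⊆ Icc a b := Icc_subset_Icc hat htb
  have hmt : t ∈ Icc t (t + h) := ⟨le_rfl, by linarith⟩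
  have key := (convex_Icc t (t + h)).norm_image_sub_le_of_norm_hasDerivWithin_le
    (f := fun s => β s - s • f (t, β t)) (f' := fun s => f (s, β s) - f (t, β t))
    (C := K * (1 + M) * h)
    (fun s hs => by
      simpa using ((hβ s (hsub hs)).fun_sub
        ((hasDerivAt_id' s).fun_smul (hasDerivAt_const s (f (t, β t))))).hasDerivWithinAt)
    (fun s hs => by
      have h1 := hf.dist_le_mul (s, β s) (t, β t)
      rw [dist_eq_norm] at h1
      refine h1.trans ?_
      rw [mul_assoc (K : ℝ)]
      gcongr
      have h2 := hlip s (hsub hs) t (hsub hmt)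
      have h3 : |s - t| ≤ h := abs_le.2 ⟨by linarith [hs.1], by linarith [hs.2]⟩
      rw [Prod.dist_eq, Real.dist_eq, dist_eq_norm]
      have h4 : M * |s - t| ≤ M * h := by gcongr
      refine max_le ?_ ?_ <;> nlinarith)
    hmt (⟨by linarith, le_rfl⟩ : t + h ∈ Icc t (t + h))
  have e : β (t + h) - β t - h • f (t, β t)
      = β (t + h) - (t + h) • f (t, β t) - (β t - t • f (t, β t)) := by module
  rw [e]
  simpa [abs_of_nonneg hh] using key

/-- A barrier for the tube of trajectories issued from `Om0`: a compactly supported Lipschitz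
function which vanishes on the tube over `[0, T]` (only there within `Om`), and which is
infinitesimally nonincreasing along `f` near `[0, T] × Om`. -/
lemma exists_tube_barrier {n : ℕ} {f : ℝ × Vec n → Vec n} {K : ℝ≥0} (hf : LipschitzWith K f)
    {T : ℝ} (hT : 0 < T) {Om Om0 : Set (Vec n)} (hOm : IsCompact Om) (hOm0 : IsCompact Om0)
    (hne : Om0.Nonempty) :
    ∃ (D : ℝ × Vec n → ℝ) (C : ℝ≥0) (R : ℝ), LipschitzWith C D ∧ (∀ p, R < ‖p‖ → D p = 0) ∧
      (∀ p, 0 ≤ D p) ∧ (∀ om ∈ Om0, D (0, om) = 0) ∧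
      (∀ t ∈ Icc 0 T, ∀ om ∈ Om, D (t, om) = 0 → ∃ β : ℝ → Vec n, β 0 ∈ Om0 ∧
        (∀ s ∈ Icc 0 T, HasDerivAt β (f (s, β s)) s) ∧ β t = om) ∧
      ∃ C' r : ℝ, 0 < r ∧ ∀ p ∈ Icc 0 T ×ˢ Om, ∀ q : ℝ × Vec n, ‖q‖ ≤ r → ∀ h ∈ Icc 0 r,
        D (p - q + h • (1, f p)) ≤ D (p - q) + C' * h * (‖q‖ + h) := by
  obtain ⟨r0, hr0⟩ := hOm0.isBounded.subset_closedBall (0 : Vec n)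
  obtain ⟨R0, hR0⟩ := hOm.isBounded.subset_closedBall (0 : Vec n)
  set τ := T + 1 with hτ
  have hτ0 : 0 ≤ τ := by linarith
  obtain ⟨α, hα, ⟨L, hL⟩, B, hB⟩ := exists_flow_of_lipschitzWith hf r0.toNNReal hτ0
  have hmem : ∀ x ∈ Om0, x ∈ closedBall (0 : Vec n) r0.toNNReal := fun x hx =>
    closedBall_subset_closedBall (Real.le_coe_toNNReal r0) (hr0 hx)
  have hB0 : 0 ≤ B := by
    obtain ⟨x, hx⟩ := hne
    exact (norm_nonneg _).trans (hB x (hmem x hx) 0 ⟨by linarith, hτ0⟩)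
  set M : ℝ := ‖f (0, 0)‖ + K * (τ + B) with hM
  have hM0 : 0 ≤ M := by positivity
  have hspeed : ∀ x ∈ Om0, ∀ t ∈ Icc (-τ) τ, ‖f (t, α x t)‖ ≤ M := by
    intro x hx t ht
    have h1 := hf.dist_le_mul (t, α x t) (0, 0)
    have h2 : dist (t, α x t) ((0 : ℝ), (0 : Vec n)) ≤ τ + B := by
      rw [Prod.dist_eq, dist_zero_right, dist_zero_right, Real.norm_eq_abs]
      exact max_le (by linarith [abs_le.2 ht]) (by linarith [hB x (hmem x hx) t ht])
    have h3 : ‖f (t, α x t)‖ ≤ dist (f (t, α x t)) (f (0, 0)) + ‖f (0, 0)‖ := by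
      rw [dist_eq_norm]; exact norm_le_norm_sub_add _ _
    have h4 : (K : ℝ) * dist (t, α x t) ((0 : ℝ), (0 : Vec n)) ≤ K * (τ + B) := by gcongr
    rw [hM]; linarith
  have hlip : ∀ x ∈ Om0, ∀ s ∈ Icc (-τ) τ, ∀ t ∈ Icc (-τ) τ,
      ‖α x s - α x t‖ ≤ M * |s - t| := fun x hx s hs t ht =>
    (convex_Icc (-τ) τ).norm_image_sub_le_of_norm_hasDerivWithin_le
      (fun u hu => ((hα x (hmem x hx)).2 u hu).hasDerivWithinAt) (hspeed x hx) ht hs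
  -- the truncated time
  set c : ℝ → ℝ := fun t => projIcc (-τ) τ (by linarith) t with hc
  have hcmem : ∀ t, c t ∈ Icc (-τ) τ := fun t => (projIcc (-τ) τ (by linarith) t).2
  have hcself : ∀ t ∈ Icc (-τ) τ, c t = t := fun t ht => by simp [hc, projIcc_of_mem _ ht]
  have hclip : ∀ s t, |c s - c t| ≤ |s - t| := fun s t => by
    simpa [Subtype.dist_eq, Real.dist_eq] using
      (LipschitzWith.projIcc (by linarith : -τ ≤ τ)).dist_le_mul s t
  -- the distance to the tube
  obtain ⟨d, hd_att, hd_le⟩ : ∃ d : ℝ × Vec n → ℝ,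
      (∀ p, ∃ x ∈ Om0, d p = dist p.2 (α x (c p.1))) ∧
      ∀ p, ∀ x ∈ Om0, d p ≤ dist p.2 (α x (c p.1)) := by
    refine ⟨fun p => infDist p.2 ((fun x => α x (c p.1)) '' Om0), fun p => ?_, fun p x hx =>
      infDist_le_dist_of_mem (mem_image_of_mem _ hx)⟩
    have hcpt : IsCompact ((fun x => α x (c p.1)) '' Om0) :=
      hOm0.image_of_continuousOn ((hL _ (hcmem p.1)).continuousOn.mono hmem)
    obtain ⟨_, ⟨x, hx, rfl⟩, h⟩ := hcpt.exists_infDist_eq_dist (hne.image _) p.2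
    exact ⟨x, hx, h⟩
  have hd0 : ∀ p, 0 ≤ d p := fun p => by
    obtain ⟨x, -, h⟩ := hd_att p
    rw [h]; exact dist_nonneg
  have hdlip : LipschitzWith (1 + ⟨M, hM0⟩) d := by
    refine LipschitzWith.of_le_add_mul _ fun p p' => ?_
    obtain ⟨x, hx, h⟩ := hd_att p'
    have h1 := hlip x hx _ (hcmem p'.1) _ (hcmem p.1)
    have h2 : M * |c p'.1 - c p.1| ≤ M * dist p p' := by
      gcongr
      refine (hclip _ _).trans ?_
      rw [Prod.dist_eq, dist_comm, Real.dist_eq]; exact le_max_left _ _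
    have h3 : dist p.2 p'.2 ≤ dist p p' := by rw [Prod.dist_eq]; exact le_max_right _ _
    have h4 := dist_triangle4 p.2 p'.2 (α x (c p'.1)) (α x (c p.1))
    rw [← dist_eq_norm] at h1
    have h5 := hd_le p x hx
    have : ((1 + ⟨M, hM0⟩ : ℝ≥0) : ℝ) = 1 + M := rfl
    rw [this, h]
    linarith
  have hdbd : ∀ p, d p ≤ ‖p‖ + B := fun p => by
    obtain ⟨x, hx⟩ := hne
    refine (hd_le p x hx).trans ((dist_le_norm_add_norm _ _).trans ?_)
    exact add_le_add (norm_snd_le p) (hB x (hmem x hx) _ (hcmem _))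
  set R1 : ℝ := max R0 T + 1 / 2 with hR1
  have hR1T : T ≤ R1 - 1 / 2 := by rw [hR1]; linarith [le_max_right R0 T]
  have hR10 : R0 ≤ R1 - 1 / 2 := by rw [hR1]; linarith [le_max_left R0 T]
  set R : ℝ := 2 * R1 + B with hR
  set g : ℝ × Vec n → ℝ := fun p => min (d p) (max 0 (R - ‖p‖)) with hg
  have hg0 : ∀ p, 0 ≤ g p := fun p => le_min (hd0 p) (le_max_left _ _)
  have hgR : ∀ p, g p ≤ R := fun p => (min_le_right _ _).trans
    (max_le (by rw [hR]; linarith) (by linarith [norm_nonneg p]))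
  have hgd : ∀ p, ‖p‖ ≤ R1 → g p = d p := fun p hp =>
    min_eq_left (le_max_of_le_right (by rw [hR]; linarith [hdbd p]))
  obtain ⟨Cg, hglip⟩ : ∃ Cg, LipschitzWith Cg g :=
    ⟨_, hdlip.min (((LipschitzWith.const R).sub lipschitzWith_one_norm).const_max 0)⟩
  set E : ℝ → ℝ := fun t => Real.exp (-K * c t) with hE
  set Λ := Real.exp (K * τ) with hΛ
  have harg : ∀ t, -K * c t ≤ K * τ := fun t => by
    have := mul_le_mul_of_nonneg_left (neg_le.1 (hcmem t).1) K.2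
    simp only [NNReal.val_eq_coe] at this
    linarith
  have hEpos : ∀ t, 0 < E t := fun t => Real.exp_pos _
  have hEle : ∀ t, E t ≤ Λ := fun t => Real.exp_le_exp.2 (harg t)
  have hElip : ∀ s t, |E s - E t| ≤ Λ * K * |s - t| := fun s t => by
    refine (abs_exp_sub_exp_le (harg s) (harg t)).trans ?_
    rw [← mul_sub, abs_mul, abs_neg, NNReal.abs_eq, mul_assoc]
    exact mul_le_mul_of_nonneg_left (mul_le_mul_of_nonneg_left (hclip s t) K.2) (Real.exp_pos _).le
  have hRnn : 0 ≤ R := (hg0 0).trans (hgR 0)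
  have hnorm : ∀ t ∈ Icc 0 T, ∀ om ∈ Om, ‖(t, om)‖ ≤ R1 - 1 / 2 := fun t ht om hom => by
    rw [Prod.norm_def]
    refine max_le ?_ ?_
    · rw [Real.norm_eq_abs, abs_of_nonneg ht.1]; exact ht.2.trans hR1T
    · exact le_trans (by simpa using hR0 hom) hR10
  refine ⟨fun p => E p.1 * g p, ⟨Λ * Cg + Λ * K * R, by positivity⟩, R,
    LipschitzWith.of_dist_le_mul fun p p' => ?_, fun p hp => ?_,
    fun p => mul_nonneg (hEpos _).le (hg0 p), fun om hom => ?_, fun t ht om hom h0 => ?_,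
    Λ * K * (1 + M), 1 / 2, by norm_num, ?_⟩
  · have h1 : |g p - g p'| ≤ Cg * dist p p' := hglip.dist_le_mul p p'
    have h2 : |E p.1 - E p'.1| ≤ Λ * K * dist p p' := by
      refine (hElip _ _).trans ?_
      gcongr
      rw [← Real.dist_eq, Prod.dist_eq]; exact le_max_left _ _
    have e : E p.1 * g p - E p'.1 * g p'
        = E p.1 * (g p - g p') + (E p.1 - E p'.1) * g p' := by ring
    rw [Real.dist_eq, e]
    refine (abs_add_le _ _).trans ?_
    rw [abs_mul, abs_mul, abs_of_pos (hEpos _), abs_of_nonneg (hg0 p')]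
    calc E p.1 * |g p - g p'| + |E p.1 - E p'.1| * g p'
        ≤ Λ * (Cg * dist p p') + (Λ * K * dist p p') * R := by
          gcongr
          · exact hEle _
          · exact hg0 _
          · exact hgR _
      _ = (Λ * Cg + Λ * K * R) * dist p p' := by ring
  · have : g p = 0 := by
      simp only [hg]
      rw [max_eq_left (by linarith), min_eq_right (hd0 p)]
    simp [this]
  · have h1 : d (0, om) ≤ 0 := by
      have := hd_le (0, om) om hom
      simpa [hcself 0 ⟨by linarith, hτ0⟩, (hα om (hmem om hom)).1] using this
    have : g (0, om) = 0 := le_antisymm ((min_le_left _ _).trans h1) (hg0 _)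
    simp [this]
  · have h1 : g (t, om) = 0 := (mul_eq_zero.1 h0).resolve_left (hEpos _).ne'
    rw [hgd _ (by linarith [hnorm t ht om hom])] at h1
    obtain ⟨x, hx, h2⟩ := hd_att (t, om)
    refine ⟨α x, by rwa [(hα x (hmem x hx)).1], fun s hs => (hα x (hmem x hx)).2 s
      ⟨by linarith [hs.1], by linarith [hs.2]⟩, ?_⟩
    rw [h1, hcself t ⟨by linarith [ht.1], by linarith [ht.2]⟩] at h2
    exact (dist_eq_zero.1 h2.symm).symm
  · rintro p ⟨hp1, hp2⟩ q hq h ⟨hh0, hh⟩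
    have hq1 : |q.1| ≤ ‖q‖ := by simpa using norm_fst_le q
    have hq2 : ‖q.2‖ ≤ ‖q‖ := norm_snd_le q
    obtain ⟨hq3, hq4⟩ := abs_le.1 (hq1.trans hq)
    set x := p - q with hx
    have hx1 : x.1 = p.1 - q.1 := rfl
    have hx2 : x.2 = p.2 - q.2 := rfl
    have hxt : x.1 ∈ Icc (-τ) τ := ⟨by linarith [hp1.1], by linarith [hp1.2]⟩
    have hxh : x.1 + h ∈ Icc (-τ) τ := ⟨by linarith [hp1.1], by linarith [hp1.2]⟩
    have hxn : ‖x‖ ≤ R1 := by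
      have := hnorm p.1 hp1 p.2 hp2
      linarith [norm_sub_le p q]
    obtain ⟨y, hy, hdy⟩ := hd_att x
    rw [hcself _ hxt] at hdy
    have htay := norm_sub_sub_smul_le_of_hasDerivAt hf hM0 (hα y (hmem y hy)).2 (hlip y hy) hh0
      hxt.1 hxh.2
    have hfd : ‖f p - f (x.1, α y x.1)‖ ≤ K * (‖q‖ + d x) := by
      rw [← dist_eq_norm]
      refine (hf.dist_le_mul _ _).trans ?_
      gcongr
      rw [Prod.dist_eq]
      refine max_le ?_ ?_
      · rw [Real.dist_eq, hx1]; simp only [sub_sub_cancel]; linarith [hd0 x]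
      · simp only
        have h1 := dist_triangle p.2 x.2 (α y x.1)
        have h2 : dist p.2 x.2 = ‖q.2‖ := by rw [dist_eq_norm, hx2, sub_sub_cancel]
        linarith
    have hdx : d (x + h • (1, f p)) ≤ (1 + K * h) * d x + K * (1 + M) * h * (‖q‖ + h) := by
      refine (hd_le _ y hy).trans ?_
      have e1 : (x + h • ((1 : ℝ), f p)).1 = x.1 + h := by simp
      have e2 : (x + h • ((1 : ℝ), f p)).2 = x.2 + h • f p := by simp
      rw [e1, e2, hcself _ hxh, dist_eq_norm]
      have e3 : x.2 + h • f p - α y (x.1 + h) = (x.2 - α y x.1) +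
          h • (f p - f (x.1, α y x.1)) -
          (α y (x.1 + h) - α y x.1 - h • f (x.1, α y x.1)) := by module
      rw [e3]
      have h1 : ‖h • (f p - f (x.1, α y x.1))‖ ≤ h * (K * (‖q‖ + d x)) := by
        rw [norm_smul, Real.norm_eq_abs, abs_of_nonneg hh0]; gcongr
      rw [dist_eq_norm] at hdy
      have h2 := norm_sub_le ((x.2 - α y x.1) + h • (f p - f (x.1, α y x.1)))
        (α y (x.1 + h) - α y x.1 - h • f (x.1, α y x.1))
      have h3 := norm_add_le (x.2 - α y x.1) (h • (f p - f (x.1, α y x.1)))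
      have h4 : 0 ≤ K * M * h * ‖q‖ := by positivity
      nlinarith
    have hEh : E (x.1 + h) * (1 + K * h) ≤ E x.1 := by
      simp only [hE, hcself _ hxt, hcself _ hxh]
      have h1 : Real.exp (-K * x.1) = Real.exp (-K * (x.1 + h)) * Real.exp (K * h) := by
        rw [← Real.exp_add]; ring_nf
      rw [h1]
      gcongr
      linarith [Real.add_one_le_exp (K * h)]
    have e1 : (x + h • ((1 : ℝ), f p)).1 = x.1 + h := by simp
    simp only [e1]
    rw [hgd x hxn]
    calc E (x.1 + h) * g (x + h • (1, f p))
        ≤ E (x.1 + h) * ((1 + K * h) * d x + K * (1 + M) * h * (‖q‖ + h)) := by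
          refine mul_le_mul_of_nonneg_left ((min_le_left _ _).trans hdx) (hEpos _).le
      _ = E (x.1 + h) * (1 + K * h) * d x + E (x.1 + h) * (K * (1 + M) * h * (‖q‖ + h)) := by ring
      _ ≤ E x.1 * d x + Λ * (K * (1 + M) * h * (‖q‖ + h)) := by
          gcongr
          · exact hd0 x
          · exact hEle _
      _ = _ := by ring

/-- The coordinates `(t, ω₁, …, ωₙ)` of a point of `ℝ × ℝⁿ`. -/
def timeCoords {n : ℕ} (p : ℝ × Vec n) : Fin (n + 1) → ℝ := Fin.cons p.1 fun i => p.2 i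

lemma contDiff_timeCoords_apply {n : ℕ} (j : Fin (n + 1)) {m : WithTop ℕ∞} :
    ContDiff ℝ m fun p : ℝ × Vec n => timeCoords p j := by
  refine Fin.cases ?_ (fun i => ?_) j
  · simpa [timeCoords] using contDiff_fst
  · simp only [timeCoords, Fin.cons_succ]
    fun_prop

lemma contDiff_eval_timeCoords {n : ℕ} (W : MvPolynomial (Fin (n + 1)) ℝ) {m : WithTop ℕ∞} :
    ContDiff ℝ m fun p : ℝ × Vec n => MvPolynomial.eval (timeCoords p) W := by
  simp only [MvPolynomial.eval_eq']
  exact ContDiff.sum fun d _ => contDiff_const.mul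
    (contDiff_prod fun i _ => (contDiff_timeCoords_apply i).pow _)

lemma timeCoords_sub {n : ℕ} (p q : ℝ × Vec n) (j : Fin (n + 1)) :
    timeCoords (p - q) j = timeCoords p j - timeCoords q j := by
  refine Fin.cases ?_ (fun i => ?_) j <;> simp [timeCoords]

lemma abs_timeCoords_le {n : ℕ} (p : ℝ × Vec n) (j : Fin (n + 1)) : |timeCoords p j| ≤ ‖p‖ := by
  refine Fin.cases ?_ (fun i => ?_) j
  · simpa [timeCoords] using norm_fst_le p
  · simpa [timeCoords] using (PiLp.norm_apply_le p.2 i).trans (norm_snd_le p)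

/-- The Landau kernel `1 - c |q|²`. -/
def landauKernel {n : ℕ} (c : ℝ) (q : ℝ × Vec n) : ℝ := 1 - c * ∑ j, timeCoords q j ^ 2

lemma continuous_landauKernel {n : ℕ} (c : ℝ) : Continuous (landauKernel (n := n) c) := by
  have h : ∀ j, Continuous fun p : ℝ × Vec n => timeCoords p j := fun j =>
    (contDiff_timeCoords_apply (m := 0) j).continuous
  unfold landauKernel
  fun_prop

lemma landauKernel_zero {n : ℕ} (c : ℝ) : landauKernel c (0 : ℝ × Vec n) = 1 := by
  have h : ∀ j, timeCoords (0 : ℝ × Vec n) j = 0 := fun j => by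
    simpa using timeCoords_sub (0 : ℝ × Vec n) 0 j
  simp [landauKernel, h]

lemma landauKernel_lt_one {n : ℕ} {c : ℝ} (hc : 0 < c) {q : ℝ × Vec n} (hq : q ≠ 0) :
    landauKernel c q < 1 := by
  obtain ⟨j, hj⟩ : ∃ j, timeCoords q j ≠ 0 := by
    by_contra! h
    refine hq (Prod.ext (by simpa [timeCoords] using h 0) ?_)
    ext i
    simpa [timeCoords] using h i.succ
  have : 0 < ∑ j, timeCoords q j ^ 2 :=
    Finset.sum_pos' (fun _ _ => sq_nonneg _) ⟨j, Finset.mem_univ j, by positivity⟩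
  have := mul_pos hc this
  unfold landauKernel
  linarith

lemma landauKernel_nonneg {n : ℕ} {c ρ : ℝ} (hc : 0 ≤ c) (hcρ : c * ((n + 1) * ρ ^ 2) ≤ 1)
    {q : ℝ × Vec n} (hq : ‖q‖ ≤ ρ) : 0 ≤ landauKernel c q := by
  have h : ∑ j, timeCoords q j ^ 2 ≤ (n + 1) * ρ ^ 2 := by
    calc ∑ j, timeCoords q j ^ 2 ≤ ∑ _j : Fin (n + 1), ρ ^ 2 :=
          Finset.sum_le_sum fun j _ =>
            sq_le_sq' (abs_le.1 ((abs_timeCoords_le q j).trans hq)).1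
              (abs_le.1 ((abs_timeCoords_le q j).trans hq)).2
      _ = _ := by simp
  have := mul_le_mul_of_nonneg_left h hc
  unfold landauKernel
  linarith

/-- Convolving with a power of the Landau kernel yields a polynomial. -/
lemma exists_eval_eq_integral_landauKernel {n : ℕ} {v : ℝ × Vec n → ℝ} (hv : Continuous v)
    (hvc : HasCompactSupport v) (c : ℝ) (m : ℕ) :
    ∃ W : MvPolynomial (Fin (n + 1)) ℝ, ∀ p : ℝ × Vec n,
      MvPolynomial.eval (timeCoords p) W = ∫ q, v q * landauKernel c (p - q) ^ m := by
  let x : Fin (n + 1) → C(ℝ × Vec n, ℝ) := fun j =>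
    ⟨fun p => timeCoords p j, (contDiff_timeCoords_apply (m := 0) j).continuous⟩
  let G : MvPolynomial (Fin (n + 1)) C(ℝ × Vec n, ℝ) :=
    (1 - MvPolynomial.C (ContinuousMap.const _ c) *
      ∑ j, (MvPolynomial.X j - MvPolynomial.C (x j)) ^ 2) ^ m
  let e : ℝ × Vec n → C(ℝ × Vec n, ℝ) →+* ℝ := fun q =>
    (Pi.evalRingHom (fun _ => ℝ) q).comp ContinuousMap.coeFnRingHom
  have hG : ∀ p q : ℝ × Vec n, landauKernel c (p - q) ^ m =
      ∑ d ∈ G.support, G.coeff d q * ∏ i, timeCoords p i ^ d i := by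
    intro p q
    have h1 : MvPolynomial.eval₂ (e q) (timeCoords p) G = landauKernel c (p - q) ^ m := by
      simp [G, e, x, landauKernel, timeCoords_sub, MvPolynomial.eval₂_pow,
        MvPolynomial.eval₂_sum, MvPolynomial.eval₂_mul, MvPolynomial.eval₂_sub]
    rw [← h1, MvPolynomial.eval₂_eq']
    rfl
  refine ⟨∑ d ∈ G.support, MvPolynomial.C (∫ q, v q * G.coeff d q) *
    ∏ i, MvPolynomial.X i ^ d i, fun p => ?_⟩
  simp only [hG, Finset.mul_sum, ← mul_assoc]
  rw [integral_finsetSum]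
  · simp [integral_mul_const]
  · intro d _
    refine Integrable.mul_const ?_ _
    exact (hv.mul (G.coeff d).continuous).integrable_of_hasCompactSupport hvc.mul_right

/-- A lower bound for difference quotients passes to the directional derivative. -/
lemma le_fderiv_of_forall_slope {E : Type*} [NormedAddCommGroup E] [NormedSpace ℝ E]
    {V : E → ℝ} {p u : E} (hV : DifferentiableAt ℝ V p) {a b r : ℝ} (hr : 0 < r)
    (h : ∀ s ∈ Ioc 0 r, a - b * s ≤ s⁻¹ • (V (p + s • u) - V p)) : a ≤ fderiv ℝ V p u := by
  have hder : HasDerivAt (fun s : ℝ => V (p + s • u)) (fderiv ℝ V p u) 0 := by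
    have h1 : HasFDerivAt V (fderiv ℝ V p) (p + (0 : ℝ) • u) := by
      rw [zero_smul, add_zero]
      exact hV.hasFDerivAt
    have h2 : HasDerivAt (fun s : ℝ => p + s • u) u 0 := by
      simpa using ((hasDerivAt_id (0 : ℝ)).smul_const u).const_add p
    exact h1.comp_hasDerivAt 0 h2
  have hlim := hder.tendsto_slope_zero_right
  simp only [zero_add, zero_smul, add_zero] at hlim
  have hlow : Tendsto (fun s : ℝ => a - b * s) (𝓝[>] 0) (𝓝 a) := by
    have : Continuous fun s : ℝ => a - b * s := by fun_prop
    simpa using (this.tendsto 0).mono_left nhdsWithin_le_nhds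
  exact le_of_tendsto_of_tendsto hlow hlim (by
    filter_upwards [Ioc_mem_nhdsGT hr] with s hs using h s hs)

/-- Polynomial smoothing of a compactly supported Lipschitz function which is infinitesimally
nondecreasing along `(1, f)` near a compact set, almost preserving this monotonicity. -/
lemma exists_polynomial_smoothing {n : ℕ} {f : ℝ × Vec n → Vec n} (hf : Continuous f)
    {v : ℝ × Vec n → ℝ} {C : ℝ≥0} (hv : LipschitzWith C v) {R : ℝ} (hvR : ∀ p, R < ‖p‖ → v p = 0)
    {Q : Set (ℝ × Vec n)} (hQ : IsCompact Q) {C' r : ℝ} (hr : 0 < r)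
    (hstep : ∀ p ∈ Q, ∀ q : ℝ × Vec n, ‖q‖ ≤ r → ∀ h ∈ Icc 0 r,
      v (p - q) - C' * h * (‖q‖ + h) ≤ v (p - q + h • (1, f p)))
    {ε : ℝ} (hε : 0 < ε) :
    ∃ W : MvPolynomial (Fin (n + 1)) ℝ, ∀ p ∈ Q,
      |MvPolynomial.eval (timeCoords p) W - v p| ≤ ε ∧
      -ε ≤ fderiv ℝ (fun p => MvPolynomial.eval (timeCoords p) W) p (1, f p) := by
  wlog hC' : 0 ≤ C' generalizing C'
  · refine this (C' := 0) (fun p hp q hq h hh => ?_) le_rfl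
    have h1 : 0 ≤ h * (‖q‖ + h) := mul_nonneg hh.1 (add_nonneg (norm_nonneg _) hh.1)
    have := hstep p hp q hq h hh
    nlinarith
  obtain ⟨U, hU⟩ := hQ.exists_bound_of_continuousOn
    (f := fun p => ((1 : ℝ), f p)) (by fun_prop : Continuous _).continuousOn
  obtain ⟨RQ, hRQ⟩ := hQ.isBounded.subset_closedBall (0 : ℝ × Vec n)
  set ρ : ℝ := |RQ| + |U| + |R| + 1 with hρ
  have hρ0 : 0 < ρ := by positivity
  set s : Set (ℝ × Vec n) := closedBall 0 ρ with hs
  have hsc : IsCompact s := isCompact_closedBall _ _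
  set c : ℝ := ((n + 1) * ρ ^ 2)⁻¹ with hc
  have hc0 : 0 < c := by positivity
  have hcρ : c * ((n + 1) * ρ ^ 2) ≤ 1 := (inv_mul_cancel₀ (by positivity)).le
  set k : ℝ × Vec n → ℝ := landauKernel c with hk
  have hkc : Continuous k := continuous_landauKernel c
  have hk0 : ∀ q ∈ s, 0 ≤ k q := fun q hq => landauKernel_nonneg hc0.le hcρ (by simpa [hs] using hq)
  have hpeak : ∀ g : ℝ × Vec n → ℝ, Continuous g → Tendsto
      (fun m : ℕ => (∫ q in s, k q ^ m)⁻¹ • ∫ q in s, k q ^ m • g q) atTop (𝓝 (g 0)) :=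
    fun g hg => tendsto_setIntegral_pow_smul_of_unique_maximum_of_isCompact_of_continuousOn hsc
      hkc.continuousOn
      (fun y _ hy => by rw [hk, landauKernel_zero]; exact landauKernel_lt_one hc0 hy) hk0
      (by rw [hk, landauKernel_zero]; exact one_pos)
      (subset_closure (by
        rw [hs, mem_interior_iff_mem_nhds]; exact closedBall_mem_nhds _ hρ0)) hg.continuousOn
  set C'' : ℝ := C' + C * |U| / r with hC''
  have hC''0 : 0 ≤ C'' := by positivity
  obtain ⟨m, hm1, hm2⟩ : ∃ m : ℕ, (∫ q in s, k q ^ m) ≠ 0 ∧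
      (∫ q in s, k q ^ m)⁻¹ * ∫ q in s, k q ^ m * ‖q‖ < ε / (C + C'' + 1) := by
    have h1 := (hpeak (fun _ => 1) continuous_const).eventually_ne (one_ne_zero)
    have h2 := (hpeak (fun q => ‖q‖) continuous_norm).eventually_lt_const
      (u := ε / (C + C'' + 1)) (by rw [norm_zero]; positivity)
    obtain ⟨m, h1, h2⟩ := (h1.and h2).exists
    refine ⟨m, fun h => h1 (by simp [h]), by simpa using h2⟩
  set I := ∫ q in s, k q ^ m with hI
  have hI0 : 0 < I := lt_of_le_of_ne
    (setIntegral_nonneg hsc.measurableSet fun q hq => pow_nonneg (hk0 q hq) m) (Ne.symm hm1)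
  set w := I⁻¹ * ∫ q in s, k q ^ m * ‖q‖ with hw
  have hw0 : 0 ≤ w := mul_nonneg (inv_nonneg.2 hI0.le) (setIntegral_nonneg hsc.measurableSet
    fun q hq => mul_nonneg (pow_nonneg (hk0 q hq) m) (norm_nonneg q))
  have hint : ∀ g : ℝ × Vec n → ℝ, Continuous g → IntegrableOn (fun q => k q ^ m * g q) s :=
    fun g hg => ((hkc.pow m).mul hg).continuousOn.integrableOn_compact hsc
  have hmono : ∀ g₁ g₂ : ℝ × Vec n → ℝ, Continuous g₁ → Continuous g₂ → (∀ q ∈ s, g₁ q ≤ g₂ q) →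
      I⁻¹ * ∫ q in s, k q ^ m * g₁ q ≤ I⁻¹ * ∫ q in s, k q ^ m * g₂ q :=
    fun g₁ g₂ h₁ h₂ h => mul_le_mul_of_nonneg_left
      (setIntegral_mono_on (hint g₁ h₁) (hint g₂ h₂) hsc.measurableSet fun q hq =>
        mul_le_mul_of_nonneg_left (h q hq) (pow_nonneg (hk0 q hq) m)) (inv_nonneg.2 hI0.le)
  have haff : ∀ g : ℝ × Vec n → ℝ, Continuous g → ∀ a b : ℝ,
      I⁻¹ * ∫ q in s, k q ^ m * (g q + (a + b * ‖q‖)) =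
        I⁻¹ * (∫ q in s, k q ^ m * g q) + (a + b * w) := by
    intro g hg a b
    have e : ∀ q, k q ^ m * (g q + (a + b * ‖q‖)) =
        k q ^ m * g q + (a * (k q ^ m * 1) + b * (k q ^ m * ‖q‖)) := fun q => by ring
    simp only [e]
    have i1 := hint _ hg
    have i2 := (hint (fun _ => 1) continuous_const).const_mul a
    have i3 := (hint _ continuous_norm).const_mul b
    have h1 : ∫ q in s, (k q ^ m * g q + (a * (k q ^ m * 1) + b * (k q ^ m * ‖q‖))) =
        (∫ q in s, k q ^ m * g q) + ∫ q in s, (a * (k q ^ m * 1) + b * (k q ^ m * ‖q‖)) :=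
      integral_add i1 (i2.add i3)
    have h2 : ∫ q in s, (a * (k q ^ m * 1) + b * (k q ^ m * ‖q‖)) =
        (∫ q in s, a * (k q ^ m * 1)) + ∫ q in s, b * (k q ^ m * ‖q‖) := integral_add i2 i3
    rw [h1, h2, integral_const_mul, integral_const_mul]
    simp only [mul_one, hw]
    rw [← hI]
    field_simp
  have hvc : HasCompactSupport v := HasCompactSupport.intro (isCompact_closedBall 0 R)
    fun p hp => hvR p (by simpa using hp)
  obtain ⟨W, hW⟩ := exists_eval_eq_integral_landauKernel hv.continuous hvc c m
  set V : ℝ × Vec n → ℝ := fun p => MvPolynomial.eval (timeCoords p) (MvPolynomial.C I⁻¹ * W)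
    with hV
  have hVeq : ∀ p, ‖p‖ ≤ |RQ| + |U| → V p = I⁻¹ * ∫ q in s, k q ^ m * v (p - q) := by
    intro p hp
    simp only [hV, map_mul, MvPolynomial.eval_C, hW]
    congr 1
    have : (volume : Measure (ℝ × Vec n)).IsAddHaarMeasure := by
      rw [Measure.volume_eq_prod]
      infer_instance
    rw [← integral_sub_left_eq_self (fun q => v q * landauKernel c (p - q) ^ m) volume p,
      setIntegral_eq_integral_of_forall_compl_eq_zero]
    · simp only [sub_sub_cancel]
      exact integral_congr_ae (.of_forall fun q => mul_comm _ _)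
    · intro q hq
      have h1 : ρ < ‖q‖ := by simpa [hs] using hq
      rw [hvR, mul_zero]
      have := norm_sub_norm_le q p
      rw [norm_sub_rev] at this
      linarith [le_abs_self R]
  have hεw : ∀ b : ℝ, 0 ≤ b → b ≤ C + C'' → b * w ≤ ε := by
    intro b hb hb'
    rw [lt_div_iff₀ (by positivity)] at hm2
    nlinarith
  refine ⟨MvPolynomial.C I⁻¹ * W, fun p hp => ?_⟩
  have hpn : ‖p‖ ≤ |RQ| := le_trans (by simpa using hRQ hp) (le_abs_self _)
  have hvcont : ∀ p, Continuous fun q => v (p - q) := fun p => hv.continuous.comp (by fun_prop)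
  have hlip : ∀ x y, |v x - v y| ≤ C * ‖x - y‖ := fun x y => by
    simpa [Real.dist_eq, dist_eq_norm] using hv.dist_le_mul x y
  constructor
  · change |V p - v p| ≤ ε
    rw [hVeq p (by linarith [abs_nonneg U])]
    have hw1 := hεw C C.2 (by linarith)
    have hq : ∀ q, |v (p - q) - v p| ≤ C * ‖q‖ := fun q => by
      simpa using hlip (p - q) p
    have h1 := hmono _ (fun q => 0 + (v p + C * ‖q‖)) (hvcont p) (by fun_prop)
      fun q _ => by linarith [(abs_le.1 (hq q)).2]
    have h2 := hmono (fun q => 0 + (v p + (-C) * ‖q‖)) _ (by fun_prop) (hvcont p)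
      fun q _ => by linarith [(abs_le.1 (hq q)).1]
    rw [haff _ continuous_const] at h1 h2
    simp only [mul_zero, integral_zero, zero_add] at h1 h2
    exact abs_le.2 ⟨by linarith, by linarith⟩
  · set u : ℝ × Vec n := (1, f p) with hu
    have huU : ‖u‖ ≤ |U| := (hU p hp).trans (le_abs_self _)
    have hquot : ∀ h ∈ Ioc 0 (min r 1), -(C'' * w) - C' * h ≤ h⁻¹ • (V (p + h • u) - V p) := by
      rintro h ⟨hh0, hh⟩
      have hhr := hh.trans (min_le_left _ _)
      have hh1 := hh.trans (min_le_right _ _)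
      have hhu : ‖h • u‖ ≤ h * |U| := by
        rw [norm_smul, Real.norm_eq_abs, abs_of_pos hh0]; gcongr
      have hphu : ‖p + h • u‖ ≤ |RQ| + |U| := by
        refine (norm_add_le _ _).trans (add_le_add hpn (hhu.trans ?_))
        nlinarith [abs_nonneg U]
      have key := hmono (fun q => v (p - q) + (-(C' * h * h) + (-(C'' * h)) * ‖q‖))
        (fun q => v (p + h • u - q)) ((hvcont p).add (by fun_prop)) (hvcont _) fun q _ => by
          have e : p + h • u - q = p - q + h • u := by abel
          rw [e]
          have hP : 0 ≤ C * |U| / r * h * ‖q‖ := by positivity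
          rcases le_total ‖q‖ r with hq | hq
          · have := hstep p hp q hq h ⟨hh0.le, hhr⟩
            rw [hC'']
            linear_combination this + hP
          · have h1 := (abs_le.1 (hlip (p - q + h • u) (p - q))).1
            rw [add_sub_cancel_left] at h1
            have h2 : C * ‖h • u‖ ≤ C * (h * |U|) := by gcongr
            have h3 : C * (h * |U|) ≤ C * |U| / r * h * ‖q‖ := by
              calc C * (h * |U|) = C * |U| / r * h * r := by field_simp
                _ ≤ _ := by gcongr
            have h4 : 0 ≤ C' * h * h := by positivity
            have h5 : 0 ≤ C' * h * ‖q‖ := by positivity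
            rw [hC'']
            linear_combination h1 + h2 + h3 + h4 + h5
      rw [haff _ (hvcont p), ← hVeq _ hphu, ← hVeq p (by linarith [abs_nonneg U])] at key
      rw [smul_eq_mul, inv_mul_eq_div, le_div_iff₀ hh0]
      linear_combination key
    have := le_fderiv_of_forall_slope
      ((contDiff_eval_timeCoords (m := 1) (MvPolynomial.C I⁻¹ * W)).differentiable one_ne_zero p)
      (lt_min hr one_pos) hquot
    refine le_trans ?_ this
    linarith [hεw C'' hC''0 (by linarith [show (0 : ℝ) ≤ C from C.2])]

/-- Weierstrass approximation on a compact subset of `ℝⁿ`. -/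
lemma exists_mvPolynomial_near {n : ℕ} {X : Set (Vec n)} (hX : IsCompact X) {g : Vec n → ℝ}
    (hg : ContinuousOn g X) {ε : ℝ} (hε : 0 < ε) :
    ∃ W : MvPolynomial (Fin n) ℝ, ∀ x ∈ X, |MvPolynomial.eval (fun i => x i) W - g x| < ε := by
  have : CompactSpace X := isCompact_iff_compactSpace.1 hX
  let φ : MvPolynomial (Fin n) ℝ →ₐ[ℝ] C(X, ℝ) :=
    MvPolynomial.aeval fun i => ⟨fun x => x.1 i, by fun_prop⟩
  have hφ : ∀ W x, φ W x = MvPolynomial.eval (fun i => x.1 i) W := by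
    intro W x
    induction W using MvPolynomial.induction_on with
    | C a => simp [φ]
    | add p q hp hq => simp [hp, hq]
    | mul_X p i hp => simp [hp, φ]
  have hsep : φ.range.SeparatesPoints := by
    intro x y hxy
    obtain ⟨i, hi⟩ : ∃ i, x.1 i ≠ y.1 i := by
      by_contra! h
      exact hxy (Subtype.ext (by ext i; exact h i))
    exact ⟨_, ⟨φ (MvPolynomial.X i), ⟨_, rfl⟩, rfl⟩, by simpa [hφ] using hi⟩
  obtain ⟨⟨_, W, rfl⟩, hW⟩ :=
    ContinuousMap.exists_mem_subalgebra_near_continuousMap_of_separatesPoints φ.range hsep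
      ⟨_, hg.domRestrict⟩ ε hε
  refine ⟨W, fun x hx => ?_⟩
  have := (ContinuousMap.norm_coe_le_norm _ ⟨x, hx⟩).trans_lt hW
  rw [Real.norm_eq_abs, ContinuousMap.sub_apply] at this
  rw [← hφ W ⟨x, hx⟩]
  exact this

/-- A continuous function of `(x, y)` has a polynomial lower bound in `x` which is nearly as good
as any constant lower bound. -/
lemma exists_mvPolynomial_le {n : ℕ} {β : Type*} [TopologicalSpace β] {X : Set (Vec n)}
    (hX : IsCompact X) {Y : Set β} (hY : IsCompact Y) {c : Vec n × β → ℝ}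
    (hc : ContinuousOn c (X ×ˢ Y)) (b : ℝ) {ε : ℝ} (hε : 0 < ε) :
    ∃ W : MvPolynomial (Fin n) ℝ,
      (∀ x ∈ X, ∀ y ∈ Y, MvPolynomial.eval (fun i => x i) W ≤ c (x, y)) ∧
      ∀ x ∈ X, (∀ y ∈ Y, b ≤ c (x, y)) → b - ε ≤ MvPolynomial.eval (fun i => x i) W := by
  rcases Y.eq_empty_or_nonempty with rfl | hne
  · exact ⟨MvPolynomial.C b, by simp, by simp [hε.le]⟩
  have hcx : ∀ x ∈ X, ContinuousOn (fun y => c (x, y)) Y := fun x hx =>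
    hc.comp (by fun_prop) fun y hy => ⟨hx, hy⟩
  have : CompactSpace Y := isCompact_iff_compactSpace.1 hY
  have hg : ContinuousOn (fun x => sInf ((fun y => c (x, y)) '' Y)) X := by
    rw [continuousOn_iff_continuous_domRestrict]
    have h := isCompact_univ.continuous_sInf (K := (univ : Set Y))
      (f := fun (x : X) (y : Y) => c (x.1, y.1))
      (hc.comp_continuous (f := fun p : X × Y => (p.1.1, p.2.1)) (by fun_prop)
        fun p => ⟨p.1.2, p.2.2⟩)
    refine h.congr fun x => ?_
    rw [domRestrict_apply, image_univ, image_eq_range]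
  obtain ⟨W, hW⟩ := exists_mvPolynomial_near hX hg (half_pos hε)
  refine ⟨W - MvPolynomial.C (ε / 2), fun x hx y hy => ?_, fun x hx hb => ?_⟩
  · have h1 := csInf_le (hY.image_of_continuousOn (hcx x hx)).bddBelow (mem_image_of_mem _ hy)
    have h2 := (abs_lt.1 (hW x hx)).2
    simp only [map_sub, MvPolynomial.eval_C]
    linarith
  · have h1 := le_csInf (hne.image fun y => c (x, y)) (by rintro _ ⟨y, hy, rfl⟩; exact hb y hy)
    have h2 := (abs_lt.1 (hW x hx)).1
    simp only [map_sub, MvPolynomial.eval_C]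
    linarith

/-- A continuous function exceeding `b` at every point of `Om` reached by a trajectory from `Om0`
dominates, on `[0, T] × Om`, a polynomial which is nondecreasing along trajectories and is almost
`b` on the initial set. -/
lemma exists_mvPolynomial_nondecreasing {n : ℕ} {f : ℝ × Vec n → Vec n} {K : ℝ≥0}
    (hf : LipschitzWith K f) {T : ℝ} (hT : 0 < T) {Om Om0 : Set (Vec n)} (hOm : IsCompact Om)
    (hOm0 : IsCompact Om0) (hsub : Om0 ⊆ Om) {z : Vec n → ℝ} (hz : Continuous z) {b : ℝ}
    (hb : ∀ β : ℝ → Vec n, β 0 ∈ Om0 → (∀ s ∈ Icc 0 T, HasDerivAt β (f (s, β s)) s) →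
      ∀ t ∈ Icc 0 T, β t ∈ Om → b < z (β t)) {θ : ℝ} (hθ : 0 < θ) :
    ∃ V : MvPolynomial (Fin (n + 1)) ℝ,
      (∀ om ∈ Om0, b - θ ≤ MvPolynomial.eval (timeCoords (0, om)) V) ∧
      (∀ p ∈ Icc 0 T ×ˢ Om, MvPolynomial.eval (timeCoords p) V ≤ z p.2) ∧
      ∀ p ∈ Icc 0 T ×ˢ Om,
        0 ≤ fderiv ℝ (fun p => MvPolynomial.eval (timeCoords p) V) p (1, f p) := by
  obtain ⟨M, hM⟩ := (hOm.image hz).bddBelow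
  replace hM : ∀ om ∈ Om, M ≤ z om := fun om h => hM (mem_image_of_mem z h)
  rcases Om0.eq_empty_or_nonempty with rfl | hne
  · exact ⟨MvPolynomial.C M, by simp, fun p hp => by simpa using hM _ hp.2, by simp⟩
  obtain ⟨D, C, R, hDL, hDR, hD0, hDi, hDz, C', r, hr, hstep⟩ :=
    exists_tube_barrier hf hT hOm hOm0 hne
  have hQ : IsCompact (Icc 0 T ×ˢ Om) := isCompact_Icc.prod hOm
  obtain ⟨d, hd, hDd⟩ : ∃ d > 0, ∀ p ∈ Icc 0 T ×ˢ Om, z p.2 ≤ b → d ≤ D p := by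
    set B := (Icc 0 T ×ˢ Om) ∩ {p : ℝ × Vec n | z p.2 ≤ b} with hB
    have hBc : IsCompact B :=
      hQ.inter_right (isClosed_le (hz.comp continuous_snd) continuous_const)
    rcases B.eq_empty_or_nonempty with h | h
    · exact ⟨1, one_pos, fun p hp hp' => (notMem_empty p (h ▸ ⟨hp, hp'⟩)).elim⟩
    obtain ⟨p, hp, hmin⟩ := hBc.exists_isMinOn h hDL.continuous.continuousOn
    refine ⟨D p, (hD0 p).lt_of_ne' fun h0 => ?_, fun q hq hq' => hmin ⟨hq, hq'⟩⟩
    obtain ⟨β, h1, h2, h3⟩ := hDz p.1 hp.1.1 p.2 hp.1.2 h0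
    have := hb β h1 h2 p.1 hp.1.1 (h3 ▸ hp.1.2)
    rw [h3] at this
    exact this.not_ge hp.2
  obtain ⟨N, hN, hNd⟩ : ∃ N ≥ 0, b - M ≤ N * d :=
    ⟨|b - M| / d, by positivity, by rw [div_mul_cancel₀ _ hd.ne']; exact le_abs_self _⟩
  have hdom : ∀ p ∈ Icc 0 T ×ˢ Om, b - N * D p ≤ z p.2 := by
    intro p hp
    rcases le_or_gt (z p.2) b with h | h
    · have h1 := mul_le_mul_of_nonneg_left (hDd p hp h) hN
      have h2 := hM p.2 hp.2
      linarith
    · have := mul_nonneg hN (hD0 p)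
      linarith
  set η := θ / ((N + 1) * (T + 2)) with hη
  have hη0 : 0 < η := by positivity
  have hηθ : N * η * (T + 2) ≤ θ := by
    have h1 : (N + 1) * (T + 2) * η = θ := by rw [hη]; field_simp
    have h2 : 0 ≤ η * (T + 2) := by positivity
    linear_combination h1 + h2
  obtain ⟨W, hW⟩ := exists_polynomial_smoothing hf.continuous hDL.neg (R := R)
    (fun p hp => by simp [hDR p hp]) hQ (C' := C') hr (fun p hp q hq h hh => by
      have := hstep p hp q hq h hh
      simp only [Pi.neg_apply]
      linarith) hη0
  simp only [Pi.neg_apply] at hW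
  have heval : ∀ p : ℝ × Vec n, MvPolynomial.eval (timeCoords p)
      (MvPolynomial.C (b - N * η * (T + 1)) + MvPolynomial.C N * W +
        MvPolynomial.C (N * η) * MvPolynomial.X 0) =
      b - N * η * (T + 1) + N * MvPolynomial.eval (timeCoords p) W + N * η * p.1 := by
    intro p
    simp [timeCoords]
  refine ⟨MvPolynomial.C (b - N * η * (T + 1)) + MvPolynomial.C N * W +
    MvPolynomial.C (N * η) * MvPolynomial.X 0, fun om hom => ?_, fun p hp => ?_, fun p hp => ?_⟩
  · rw [heval]
    have h1 := (abs_le.1 (hW (0, om) ⟨⟨le_rfl, hT.le⟩, hsub hom⟩).1).1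
    rw [hDi om hom] at h1
    have h2 := mul_le_mul_of_nonneg_left h1 hN
    simp only [neg_zero, sub_zero, mul_zero, add_zero] at h2 ⊢
    linear_combination h2 + hηθ
  · rw [heval]
    have h1 := (abs_le.1 (hW p hp).1).2
    have h2 := mul_le_mul_of_nonneg_left h1 hN
    have h3 : N * η * p.1 ≤ N * η * T := by
      gcongr
      exact hp.1.2
    linear_combination hdom p hp + h2 + h3
  · simp only [heval]
    have h1 : HasFDerivAt (fun p : ℝ × Vec n => MvPolynomial.eval (timeCoords p) W)
        (fderiv ℝ (fun p => MvPolynomial.eval (timeCoords p) W) p) p :=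
      ((contDiff_eval_timeCoords (m := 1) W).differentiable one_ne_zero p).hasFDerivAt
    have h2 := ((h1.const_mul N).const_add (b - N * η * (T + 1))).add
      ((hasFDerivAt_fst (𝕜 := ℝ) (p := p)).const_mul (N * η))
    have h3 := mul_le_mul_of_nonneg_left (hW p hp).2 hN
    refine le_of_le_of_eq ?_ (congrArg (fun L => L (1, f p)) h2.fderiv).symm
    simp only [add_apply, smul_apply, smul_eq_mul,
      ContinuousLinearMap.coe_fst', mul_one]
    linarith

/-- A trajectory which never comes back to `Om` after touching its frontier stays in `Om` until
each time at which it lies in `Om`. -/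
lemma forall_mem_of_forall_frontier {E : Type*} [TopologicalSpace E] {β : ℝ → E} {T : ℝ}
    {Om : Set E} (hβ : ContinuousOn β (Icc 0 T))
    (h : ∀ t ∈ Icc 0 T, β t ∈ frontier Om → ∀ t' ∈ Ioc t T, β t' ∉ Om)
    (h0 : β 0 ∈ Om) {t : ℝ} (ht : t ∈ Icc 0 T) (hmem : β t ∈ Om) : ∀ s ∈ Icc 0 t, β s ∈ Om := by
  intro s hs
  by_contra hsO
  have hg : Continuous fun r => β (projIcc 0 s hs.1 r) :=
    (hβ.mono (Icc_subset_Icc_right (hs.2.trans ht.2))).domRestrict.comp continuous_projIcc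
  obtain ⟨τ, hτ⟩ : (frontier ((fun r => β (projIcc 0 s hs.1 r)) ⁻¹' Om)).Nonempty := by
    refine nonempty_frontier_iff.2 ⟨⟨0, by simpa [projIcc_left] using h0⟩, fun h => hsO ?_⟩
    have : s ∈ (fun r => β (projIcc 0 s hs.1 r)) ⁻¹' Om := h ▸ mem_univ s
    simpa using this
  have hτ' := hg.frontier_preimage_subset Om hτ
  have hp := (projIcc 0 s hs.1 τ).2
  have hst : s < t := hs.2.lt_of_ne (by rintro rfl; exact hsO hmem)
  exact h _ ⟨hp.1, hp.2.trans (hs.2.trans ht.2)⟩ hτ' t ⟨hp.2.trans_lt hst, ht.2⟩ hmem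

end Auxiliary

/-- polynomial near-optimal certificates for the shape program.  For
every `δ > 0` there are a real `γ` and polynomials `w ∈ ℝ[x]`, `z ∈ ℝ[ω]`,
`v ∈ ℝ[t,ω]` forming a shape-dual-feasible quadruple with `P* − δ ≤ γ ≤ P*`. -/
theorem shape_polynomial_certificates {nw ns n : ℕ} (T : ℝ) (hT : 0 < T)
    (Om Om0 : Set (Vec nw)) (S : Set (Vec ns)) (X Xu : Set (Vec n))
    (hOm : IsCompact Om) (hOm0 : IsCompact Om0) (hS : IsCompact S)
    (hX : IsCompact X) (hXu : IsCompact Xu) (hOm0Om : Om0 ⊆ Om) (hXuX : Xu ⊆ X)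
    (A : Vec ns × Vec nw → Vec n) (hA : Continuous A)
    (hmaps : ∀ s ∈ S, ∀ om ∈ Om, A (s, om) ∈ X)
    (f : ℝ × Vec nw → Vec nw) (K : NNReal) (hf : LipschitzWith K f)
    (c : Vec n × Vec n → ℝ) (hc : ContinuousOn c (X ×ˢ Xu))
    (hA5 : ∀ om : ℝ → Vec nw, om 0 ∈ Om0 →
      (∀ t ∈ Icc (0 : ℝ) T, HasDerivAt om (f (t, om t)) t) →
      ∀ t ∈ Icc (0 : ℝ) T, om t ∈ frontier Om → ∀ t' ∈ Ioc t T, om t' ∉ Om)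
    (hA6 : ∀ om : ℝ → Vec nw, om 0 ∈ Om0 →
      (∀ t ∈ Icc (0 : ℝ) T, HasDerivAt om (f (t, om t)) t) →
      ∀ t ∈ Icc (0 : ℝ) T, ∀ s ∈ S, (A (s, om t) ∉ X ∨ A (s, om t) ∈ frontier X) →
      ∀ t' ∈ Ioc t T, A (s, om t') ∉ X)
    (δ : ℝ) (hδ : 0 < δ) :
    ∃ (γ : ℝ) (v : ℝ × Vec nw → ℝ) (w : Vec n → ℝ) (z : Vec nw → ℝ),
      (∃ W : MvPolynomial (Fin n) ℝ, ∀ x : Vec n,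
        w x = MvPolynomial.eval (fun i => x i) W) ∧
      (∃ Z : MvPolynomial (Fin nw) ℝ, ∀ om : Vec nw,
        z om = MvPolynomial.eval (fun i => om i) Z) ∧
      (∃ V : MvPolynomial (Fin (nw + 1)) ℝ, ∀ (t : ℝ) (om : Vec nw),
        v (t, om) = MvPolynomial.eval (Fin.cons t fun i => om i) V) ∧
      ShapeDualFeasible T Om Om0 S X Xu A f c γ v w z ∧
      ShapePStar T Om Om0 S Xu A f c - δ ≤ γ ∧
      γ ≤ ShapePStar T Om Om0 S Xu A f c := by
  set P := ShapePStar T Om Om0 S Xu A f c with hP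
  obtain ⟨W, hWc, hWb⟩ := exists_mvPolynomial_le hX hXu hc P (by positivity : 0 < δ / 8)
  have hWcont : Continuous fun x : Vec n => MvPolynomial.eval (fun i => x i) W :=
    (MvPolynomial.continuous_eval W).comp (by fun_prop)
  obtain ⟨Z, hZW, hZb⟩ := exists_mvPolynomial_le hOm hS
    (c := fun p => MvPolynomial.eval (fun i => A (p.2, p.1) i) W)
    (hWcont.comp (hA.comp continuous_swap)).continuousOn (P - δ / 8) (by positivity : 0 < δ / 8)
  have hZcont : Continuous fun om : Vec nw => MvPolynomial.eval (fun i => om i) Z :=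
    (MvPolynomial.continuous_eval Z).comp (by fun_prop)
  have hbdd : BddBelow (c '' (X ×ˢ Xu)) := ((hX.prod hXu).image_of_continuousOn hc).bddBelow
  have hPle : ∀ (om : ℝ → Vec nw) (tp : ℝ), ShapeAdmissible T Om Om0 f om tp →
      ∀ s ∈ S, ∀ y ∈ Xu, P ≤ c (A (s, om tp), y) := by
    intro om tp had s hs y hy
    refine csInf_le (hbdd.mono ?_) ⟨om, tp, s, y, had, hs, hy, rfl⟩
    rintro _ ⟨om, tp, s, y, had, hs, hy, rfl⟩
    exact mem_image_of_mem c
      ⟨hmaps s hs _ (had.2.2.2 tp ⟨had.1.1, le_rfl⟩), hy⟩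
  obtain ⟨V, hV0, hVz, hVd⟩ := exists_mvPolynomial_nondecreasing hf hT hOm hOm0 hOm0Om hZcont
    (b := P - δ / 2) (fun β h0 hβ t ht htO => by
      have hstay := forall_mem_of_forall_frontier
        (fun s hs => (hβ s hs).continuousAt.continuousWithinAt) (hA5 β h0 hβ) (hOm0Om h0) ht htO
      have had : ShapeAdmissible T Om Om0 f β t :=
        ⟨ht, h0, fun s hs => hβ s ⟨hs.1, hs.2.trans ht.2⟩, hstay⟩
      have := hZb (β t) htO fun s hs =>
        hWb _ (hmaps s hs _ htO) fun y hy => hPle β t had s hs y hy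
      linarith) (half_pos hδ)
  refine ⟨P - δ, fun p => MvPolynomial.eval (timeCoords p) V, _, _, ⟨W, fun _ => rfl⟩,
    ⟨Z, fun _ => rfl⟩, ⟨V, fun _ _ => rfl⟩, ⟨contDiff_eval_timeCoords V, hWcont, hZcont,
      fun om hom => ?_, hWc, fun s hs om hom => hZW om hom s hs,
      fun t ht om hom => hVz (t, om) ⟨ht, hom⟩, fun t ht om hom => hVd (t, om) ⟨ht, hom⟩⟩,
    le_rfl, by linarith⟩
  have := hV0 om hom
  change P - δ ≤ MvPolynomial.eval (timeCoords (0, om)) V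
  linarith
end
end
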